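/- arXiv:2203.01633 — 10 statements merged into one kernel-verified Lean document; each statement's English description precedes it below -/
import Mathlib

section
/- Let (X_i,d_i), i=1,...,N, be Polish spaces, let X := X_1×···×X_N carry the 1-product metric, and let μ_i ∈ P_1(X_i) for each i. Then for every μ̂ ∈ P_1(X) there exists a reassembly of μ̂ with marginals μ_1,...,μ_N; that is, there exist μ̃ ∈ Γ(μ_1,...,μ_N) and a Borel probability measure γ on X_1×···×X_N×X_1×···×X_N such that: the marginal of γ on the first N factors is μ̂; for each i, the marginal γ_i of γ on the pair of the i-th and (N+i)-th factors is a coupling of the i-th marginal μ̂_i of μ̂ and μ_i satisfying ∫ d_i(x,y) γ_i(dx,dy) = W_1(μ̂_i,μ_i); and the marginal of γ on the last N factors is μ̃. -/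
open MeasureTheory

noncomputable section

/-- A Borel measure on a metric space has a finite first moment, i.e. it belongs to `P_1`. -/
def HasFiniteFirstMoment {Y : Type*} [MeasurableSpace Y] [PseudoMetricSpace Y]
    (μ : Measure Y) : Prop :=
  ∃ y₀ : Y, Integrable (fun y => dist y₀ y) μ

/-- `γ` is a coupling of `μ` and `ν`. -/
def IsCoupling {Y Z : Type*} [MeasurableSpace Y] [MeasurableSpace Z]
    (γ : Measure (Y × Z)) (μ : Measure Y) (ν : Measure Z) : Prop :=
  IsProbabilityMeasure γ ∧ γ.map Prod.fst = μ ∧ γ.map Prod.snd = ν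

/-- The order-1 Wasserstein distance between two Borel probability measures on a
metric space, defined as the infimum of the expected distance over all couplings. -/
def W1 {Y : Type*} [MeasurableSpace Y] [PseudoMetricSpace Y] (μ ν : Measure Y) : ℝ :=
  sInf {r : ℝ | ∃ γ : Measure (Y × Y), IsCoupling γ μ ν ∧
    Integrable (fun q => dist q.1 q.2) γ ∧ (∫ q, dist q.1 q.2 ∂γ) = r}

/-- `γ` is a coupling of the `N` marginals `μ i`, i.e. `γ ∈ Γ(μ_1, …, μ_N)`. -/
def IsCouplingPi {N : ℕ} {X : Fin N → Type*} [∀ i, MeasurableSpace (X i)]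
    (γ : Measure (∀ i, X i)) (μ : ∀ i, Measure (X i)) : Prop :=
  IsProbabilityMeasure γ ∧ ∀ i, γ.map (fun x => x i) = μ i

/-- `μtilde` is a reassembly of `μhat` with marginals `μ_1, …, μ_N`:
`μtilde ∈ Γ(μ_1, …, μ_N)` and there is a probability measure `γ` on the product of two
copies of `X_1 × ⋯ × X_N` whose marginal on the first `N` factors is `μhat`, whose
marginal on the pair of the `i`-th and `(N+i)`-th factors is an optimal coupling (for
the cost `d_i`) of the `i`-th marginal of `μhat` and `μ i`, and whose marginal on the
last `N` factors is `μtilde`. -/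
def IsReassembly {N : ℕ} {X : Fin N → Type*} [∀ i, MeasurableSpace (X i)]
    [∀ i, MetricSpace (X i)]
    (μhat : Measure (∀ i, X i)) (μ : ∀ i, Measure (X i))
    (μtilde : Measure (∀ i, X i)) : Prop :=
  IsCouplingPi μtilde μ ∧
  ∃ γ : Measure ((∀ i, X i) × (∀ i, X i)),
    IsProbabilityMeasure γ ∧
    γ.map Prod.fst = μhat ∧
    γ.map Prod.snd = μtilde ∧
    ∀ i,
      IsCoupling (γ.map (fun q => (q.1 i, q.2 i))) (μhat.map (fun x => x i)) (μ i) ∧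
      Integrable (fun q => dist q.1 q.2) (γ.map (fun q => (q.1 i, q.2 i))) ∧
      (∫ q, dist q.1 q.2 ∂(γ.map (fun q => (q.1 i, q.2 i)))) =
        W1 (μhat.map (fun x => x i)) (μ i)

open ProbabilityTheory
open scoped ENNReal NNReal unitInterval

theorem IsCoupling.prod {Y Z : Type*} [MeasurableSpace Y] [MeasurableSpace Z]
    (μ : Measure Y) (ν : Measure Z) [IsProbabilityMeasure μ] [IsProbabilityMeasure ν] :
    IsCoupling (μ.prod ν) μ ν :=
  ⟨inferInstance, by simp [Measure.map_fst_prod], by simp [Measure.map_snd_prod]⟩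

/-- The set of couplings of two Borel probability measures on Polish spaces is weakly compact. -/
theorem isCompact_setOf_isCoupling {Y Z : Type*}
    [MeasurableSpace Y] [TopologicalSpace Y] [PolishSpace Y] [BorelSpace Y]
    [MeasurableSpace Z] [TopologicalSpace Z] [PolishSpace Z] [BorelSpace Z]
    (μ : Measure Y) (ν : Measure Z) [IsProbabilityMeasure μ] [IsProbabilityMeasure ν] :
    IsCompact {γ : ProbabilityMeasure (Y × Z) | IsCoupling (γ : Measure (Y × Z)) μ ν} := by
  let := TopologicalSpace.upgradeIsCompletelyMetrizable Y
  let := TopologicalSpace.upgradeIsCompletelyMetrizable Z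
  have tight : IsTightMeasureSet {((γ : ProbabilityMeasure (Y × Z)) : Measure (Y × Z)) |
      γ ∈ {γ : ProbabilityMeasure (Y × Z) | IsCoupling (γ : Measure (Y × Z)) μ ν}} := by
    refine IsTightMeasureSet.prodMk ?_ ?_
    · refine (isTightMeasureSet_singleton (μ := μ)).subset ?_
      rintro _ ⟨_, ⟨γ, hγ, rfl⟩, rfl⟩
      exact hγ.2.1
    · refine (isTightMeasureSet_singleton (μ := ν)).subset ?_
      rintro _ ⟨_, ⟨γ, hγ, rfl⟩, rfl⟩
      exact hγ.2.2
  have closed :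
      IsClosed {γ : ProbabilityMeasure (Y × Z) | IsCoupling (γ : Measure (Y × Z)) μ ν} := by
    have eq : {γ : ProbabilityMeasure (Y × Z) | IsCoupling (γ : Measure (Y × Z)) μ ν} =
        {γ | γ.map measurable_fst.aemeasurable = ⟨μ, inferInstance⟩} ∩
        {γ | γ.map measurable_snd.aemeasurable = ⟨ν, inferInstance⟩} := by
      ext γ
      exact ⟨fun h => ⟨Subtype.ext h.2.1, Subtype.ext h.2.2⟩,
        fun h => ⟨inferInstance, congrArg Subtype.val h.1, congrArg Subtype.val h.2⟩⟩
    rw [eq]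
    exact (isClosed_eq (ProbabilityMeasure.continuous_map continuous_fst) continuous_const).inter
      (isClosed_eq (ProbabilityMeasure.continuous_map continuous_snd) continuous_const)
  rw [← closed.closure_eq]
  exact isCompact_closure_of_isTightMeasureSet tight

/-- The integral of a nonnegative continuous function is weakly lower semicontinuous. -/
theorem lowerSemicontinuous_lintegral_continuous {Ω : Type*} [MeasurableSpace Ω]
    [TopologicalSpace Ω] [OpensMeasurableSpace Ω] {c : Ω → ℝ≥0} (hc : Continuous c) :
    LowerSemicontinuous fun γ : ProbabilityMeasure Ω => ∫⁻ x, c x ∂(γ : Measure Ω) := by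
  have eq (γ : ProbabilityMeasure Ω) : ∫⁻ x, c x ∂(γ : Measure Ω) =
      ⨆ n : ℕ, ∫⁻ x, (min (c x) n : ℝ≥0) ∂(γ : Measure Ω) := by
    rw [← lintegral_iSup]
    · refine lintegral_congr fun x => le_antisymm ?_ ?_
      · obtain ⟨n, hn⟩ := exists_nat_ge (c x)
        exact le_iSup_of_le n (by simp [hn])
      · exact iSup_le fun n => by exact_mod_cast min_le_left _ _
    · exact fun n => (hc.min continuous_const).measurable.coe_nnreal_ennreal
    · intro m n hmn x
      dsimp only
      gcongr
  simp_rw [eq]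
  refine lowerSemicontinuous_iSup fun n => Continuous.lowerSemicontinuous ?_
  exact ProbabilityMeasure.continuous_lintegral_boundedContinuousFunction
    (BoundedContinuousFunction.mkOfBound ⟨fun x => min (c x) n, hc.min continuous_const⟩ n
      fun x y => NNReal.dist_eq _ _ ▸ by
        rw [abs_sub_le_iff]
        have hx : ((min (c x) n : ℝ≥0) : ℝ) ≤ n := by exact_mod_cast min_le_right (c x) n
        have hy : ((min (c y) n : ℝ≥0) : ℝ) ≤ n := by exact_mod_cast min_le_right (c y) n
        have := (min (c x) n : ℝ≥0).coe_nonneg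
        have := (min (c y) n : ℝ≥0).coe_nonneg
        simp only [ContinuousMap.coe_mk]
        constructor <;> linarith)

/-- Existence of an optimal coupling for a nonnegative continuous cost. -/
theorem exists_isCoupling_lintegral_le {Y Z : Type*}
    [MeasurableSpace Y] [TopologicalSpace Y] [PolishSpace Y] [BorelSpace Y]
    [MeasurableSpace Z] [TopologicalSpace Z] [PolishSpace Z] [BorelSpace Z]
    (μ : Measure Y) (ν : Measure Z) [IsProbabilityMeasure μ] [IsProbabilityMeasure ν]
    {c : Y × Z → ℝ≥0} (hc : Continuous c) :
    ∃ γ, IsCoupling γ μ ν ∧ ∀ γ', IsCoupling γ' μ ν → ∫⁻ q, c q ∂γ ≤ ∫⁻ q, c q ∂γ' := by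
  obtain ⟨γ, hγ, hmin⟩ := ((lowerSemicontinuous_lintegral_continuous hc).lowerSemicontinuousOn
    _).exists_isMinOn ⟨⟨μ.prod ν, inferInstance⟩, IsCoupling.prod μ ν⟩
    (isCompact_setOf_isCoupling μ ν)
  exact ⟨γ, hγ, fun γ' hγ' => hmin (a := ⟨γ', hγ'.1⟩) hγ'⟩

/-- Measures with finite first moments admit a coupling attaining the Wasserstein distance. -/
theorem exists_isCoupling_integral_dist_eq_W1 {Y : Type*} [MeasurableSpace Y] [MetricSpace Y]
    [PolishSpace Y] [BorelSpace Y] (μ ν : Measure Y) [IsProbabilityMeasure μ]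
    [IsProbabilityMeasure ν] (hμ : HasFiniteFirstMoment μ) (hν : HasFiniteFirstMoment ν) :
    ∃ γ, IsCoupling γ μ ν ∧ Integrable (fun q => dist q.1 q.2) γ ∧
      ∫ q, dist q.1 q.2 ∂γ = W1 μ ν := by
  obtain ⟨γ, hγ, hmin⟩ := exists_isCoupling_lintegral_le μ ν
    (c := fun q => nndist q.1 q.2) continuous_nndist
  have hmeas (γ' : Measure (Y × Y)) :
      AEStronglyMeasurable (fun q : Y × Y => dist q.1 q.2) γ' :=
    continuous_dist.aestronglyMeasurable
  have integrable_iff (γ' : Measure (Y × Y)) : Integrable (fun q : Y × Y => dist q.1 q.2) γ' ↔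
      ∫⁻ q, nndist q.1 q.2 ∂γ' < ∞ := by
    rw [Integrable, and_iff_right (hmeas γ'),
      hasFiniteIntegral_iff_ofReal (ae_of_all _ fun _ => dist_nonneg)]
    simp_rw [← edist_nndist, edist_dist]
  have integral_eq (γ' : Measure (Y × Y)) : ∫ q, dist q.1 q.2 ∂γ' =
      (∫⁻ q, nndist q.1 q.2 ∂γ').toReal := by
    rw [integral_eq_lintegral_of_nonneg_ae (ae_of_all _ fun _ => dist_nonneg) (hmeas γ')]
    simp_rw [← edist_nndist, edist_dist]
  have prod_integrable : Integrable (fun q : Y × Y => dist q.1 q.2) (μ.prod ν) := by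
    obtain ⟨a, ha⟩ := hμ
    obtain ⟨b, hb⟩ := hν
    refine (((ha.comp_fst ν).add (integrable_const (dist a b))).add (hb.comp_snd μ)).mono'
      (hmeas _) (ae_of_all _ fun q => ?_)
    have := dist_triangle4 q.1 a b q.2
    simpa [dist_comm q.1 a] using this
  have γ_integrable : Integrable (fun q : Y × Y => dist q.1 q.2) γ :=
    (integrable_iff γ).2 ((hmin _ (IsCoupling.prod μ ν)).trans_lt
      ((integrable_iff _).1 prod_integrable))
  refine ⟨γ, hγ, γ_integrable, Eq.symm <| IsLeast.csInf_eq ?_⟩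
  refine ⟨⟨γ, hγ, γ_integrable, rfl⟩, ?_⟩
  rintro _ ⟨γ', hγ', hint, rfl⟩
  rw [integral_eq, integral_eq]
  exact ENNReal.toReal_mono ((integrable_iff γ').1 hint).ne (hmin γ' hγ')

/-- Every probability measure on `Y × Z` is the law of `(y, f y u)` where `y` has its first
marginal as law and `u` is an independent uniform variable. -/
theorem exists_measurable_map_prod_unitInterval_eq {Y Z : Type*} [MeasurableSpace Y]
    [MeasurableSpace Z] [StandardBorelSpace Z] (ρ : Measure (Y × Z)) [IsProbabilityMeasure ρ] :
    ∃ f : Y → I → Z, Measurable (Function.uncurry f) ∧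
      (ρ.fst.prod (volume : Measure I)).map (fun p => (p.1, f p.1 p.2)) = ρ := by
  have : Nonempty Z := ρ.nonempty_of_neZero.map Prod.snd
  obtain ⟨f, hf, hfκ⟩ := Kernel.exists_measurable_map_eq_unitInterval ρ.condKernel
  refine ⟨f, hf, ?_⟩
  have hmap : Measurable fun p : Y × I => (p.1, f p.1 p.2) := measurable_fst.prodMk hf
  conv_rhs => rw [← ρ.disintegrate ρ.condKernel]
  ext s hs
  rw [Measure.map_apply hmap hs, Measure.prod_apply (hmap hs), Measure.compProd_apply hs]
  refine lintegral_congr fun y => ?_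
  rw [← hfκ, Measure.map_apply hf.of_uncurry_left (measurable_prodMk_left hs)]
  rfl

/-- Couplings `ρ i` whose first marginals are the marginals of `μ` can be realized
simultaneously as the coordinatewise pair laws of a measure with first marginal `μ`. -/
theorem exists_map_fst_eq_and_map_eval_eq {ι : Type*} [Fintype ι] {Y Z : ι → Type*}
    [∀ i, MeasurableSpace (Y i)] [∀ i, MeasurableSpace (Z i)] [∀ i, StandardBorelSpace (Z i)]
    (μ : Measure (∀ i, Y i)) [IsProbabilityMeasure μ]
    (ρ : ∀ i, Measure (Y i × Z i)) [∀ i, IsProbabilityMeasure (ρ i)]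
    (hρ : ∀ i, (ρ i).fst = μ.map fun x => x i) :
    ∃ γ : Measure ((∀ i, Y i) × (∀ i, Z i)), IsProbabilityMeasure γ ∧ γ.map Prod.fst = μ ∧
      ∀ i, γ.map (fun q => (q.1 i, q.2 i)) = ρ i := by
  choose f hf hfρ using fun i => exists_measurable_map_prod_unitInterval_eq (ρ i)
  let F : (∀ i, Y i) × (ι → I) → (∀ i, Y i) × (∀ i, Z i) :=
    fun p => (p.1, fun i => f i (p.1 i) (p.2 i))
  have hF : Measurable F := measurable_fst.prodMk <| measurable_pi_lambda _ fun i =>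
    (hf i).comp (((measurable_pi_apply i).comp measurable_fst).prodMk
      ((measurable_pi_apply i).comp measurable_snd))
  let P : Measure ((∀ i, Y i) × (ι → I)) := μ.prod (Measure.pi fun _ => volume)
  refine ⟨P.map F, Measure.isProbabilityMeasure_map hF.aemeasurable, ?_, fun i => ?_⟩
  · rw [Measure.map_map measurable_fst hF]
    change P.map Prod.fst = μ
    simp [P, Measure.map_fst_prod]
  · have hG : Measurable fun p : Y i × I => (p.1, f i p.1 p.2) := measurable_fst.prodMk (hf i)
    have eval_map : (Measure.pi fun _ : ι => (volume : Measure I)).map (fun u => u i) = volume :=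
      (measurePreserving_eval (fun _ : ι => (volume : Measure I)) i).map_eq
    rw [Measure.map_map (by fun_prop) hF, ← hfρ i, hρ i]
    conv_rhs => rw [← eval_map, Measure.map_prod_map _ _ (measurable_pi_apply i)
      (measurable_pi_apply i), Measure.map_map hG (by fun_prop)]
    rfl

/-- **Existence of reassembly** (Lemma 2.4).  If `X_1, …, X_N` are Polish metric spaces,
the product carries the 1-product metric, `μ_i ∈ P_1(X_i)` are Borel probability measures
and `μhat ∈ P_1(X_1 × ⋯ × X_N)` is a Borel probability measure, then there exists a
reassembly of `μhat` with marginals `μ_1, …, μ_N`. -/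
theorem reassembly_exists {N : ℕ} {X : Fin N → Type*}
    [∀ i, MeasurableSpace (X i)] [∀ i, MetricSpace (X i)]
    [∀ i, PolishSpace (X i)] [∀ i, BorelSpace (X i)]
    (μ : ∀ i, Measure (X i)) (hμprob : ∀ i, IsProbabilityMeasure (μ i))
    (hμP1 : ∀ i, HasFiniteFirstMoment (μ i))
    (μhat : Measure (∀ i, X i)) (hhatprob : IsProbabilityMeasure μhat)
    (hhatP1 : ∃ x₀ : ∀ i, X i, Integrable (fun y => ∑ i, dist (x₀ i) (y i)) μhat) :
    ∃ μtilde : Measure (∀ i, X i), IsReassembly μhat μ μtilde := by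
  have hhat_prob (i : Fin N) : IsProbabilityMeasure (μhat.map fun x => x i) :=
    Measure.isProbabilityMeasure_map (measurable_pi_apply i).aemeasurable
  have hhat_moment (i : Fin N) : HasFiniteFirstMoment (μhat.map fun x => x i) := by
    obtain ⟨x₀, hx₀⟩ := hhatP1
    refine ⟨x₀ i, (integrable_map_measure (by fun_prop)
      (measurable_pi_apply i).aemeasurable).2 ?_⟩
    refine hx₀.mono' (Measurable.aestronglyMeasurable
      (measurable_const.dist (measurable_pi_apply i))) (ae_of_all _ fun y => ?_)
    simpa using Finset.single_le_sum (f := fun j => dist (x₀ j) (y j))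
      (fun _ _ => dist_nonneg) (Finset.mem_univ i)
  choose ρ hρ hρ_int hρ_W1 using fun i =>
    exists_isCoupling_integral_dist_eq_W1 _ (μ i) (hhat_moment i) (hμP1 i)
  have hρ_prob (i : Fin N) : IsProbabilityMeasure (ρ i) := (hρ i).1
  obtain ⟨γ, hγ_prob, hγ_fst, hγ⟩ :=
    exists_map_fst_eq_and_map_eval_eq μhat ρ fun i => (hρ i).2.1
  refine ⟨γ.map Prod.snd, ⟨Measure.isProbabilityMeasure_map measurable_snd.aemeasurable,
    fun i => ?_⟩, γ, hγ_prob, hγ_fst, rfl, fun i => ?_⟩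
  · rw [← (hρ i).2.2, ← hγ i, Measure.map_map (by fun_prop) (by fun_prop),
      Measure.map_map (by fun_prop) (by fun_prop)]
    rfl
  · rw [hγ i]
    exact ⟨hρ i, hρ_int i, hρ_W1 i⟩

end
end

section
/- Let the cost Assumption hold and let G_i = {g_{i,1},...,g_{i,m_i}} be a finite set of μ_i-integrable Borel functions on X_i for each i, with m := Σ_{i=1}^N m_i. Then: (i) for every ε_0 > 0 there exist q ∈ ℕ with 1 ≤ q ≤ m+2, reals α_1,...,α_q > 0 with Σ_{k=1}^q α_k = 1, and points x_1,...,x_q ∈ X such that the discrete measure μ̂ := Σ_{k=1}^q α_k δ_{x_k} belongs to Γ([μ_1]_{G_1},...,[μ_N]_{G_N}) and satisfies ∫_X f dμ̂ ≤ inf{∫_X f dμ : μ ∈ Γ([μ_1]_{G_1},...,[μ_N]_{G_N})} + ε_0; (ii) if moreover each X_i is compact and each g_{i,j} is continuous, then such a discrete measure μ̂ supported on at most m+2 points exists attaining the infimum inf{∫_X f dμ : μ ∈ Γ([μ_1]_{G_1},...,[μ_N]_{G_N})}. -/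
open MeasureTheory

noncomputable section

/-- The moment set `[μ]_G`: the set of Borel probability measures `ν ∈ P_1` that integrate
every test function `g ∈ G` and give it the same integral as `μ`. -/
def MomentSet {Y : Type*} [MeasurableSpace Y] [PseudoMetricSpace Y]
    (μ : Measure Y) (G : Set (Y → ℝ)) : Set (Measure Y) :=
  {ν | IsProbabilityMeasure ν ∧ HasFiniteFirstMoment ν ∧
    ∀ g ∈ G, Integrable g ν ∧ (∫ y, g y ∂ν) = ∫ y, g y ∂μ}

/-- `γ ∈ Γ([μ_1]_{G_1}, …, [μ_N]_{G_N})`: a probability measure on the product whose `i`-th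
marginal belongs to the moment set `[μ_i]_{G_i}` for every `i`. -/
def IsRelaxedCoupling {N : ℕ} {X : Fin N → Type*} [∀ i, MeasurableSpace (X i)]
    [∀ i, MetricSpace (X i)]
    (γ : Measure (∀ i, X i)) (μ : ∀ i, Measure (X i)) (G : ∀ i, Set (X i → ℝ)) : Prop :=
  IsProbabilityMeasure γ ∧ ∀ i, γ.map (fun x => x i) ∈ MomentSet (μ i) (G i)

/-- The set of values `∫ f dγ` over `γ ∈ S` for which `f` is integrable. -/
def OTValues {A : Type*} [MeasurableSpace A] (f : A → ℝ) (S : Set (Measure A)) : Set ℝ :=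
  {r : ℝ | ∃ γ ∈ S, Integrable f γ ∧ (∫ x, f x ∂γ) = r}

theorem exists_dual_forall_le_of_notMem {E : Type*} [NormedAddCommGroup E] [NormedSpace ℝ E]
    [FiniteDimensional ℝ E] {C : Set E} (hC : Convex ℝ C) {z : E} (hz : z ∉ C) (hne : C.Nonempty) :
    ∃ l : StrongDual ℝ E, l ≠ 0 ∧ ∀ a ∈ C, l a ≤ l z := by
  by_cases hInt : (interior C).Nonempty
  · exact geometric_hahn_banach_of_nonempty_interior_point hC
      (fun h => hz (interior_subset h)) hInt
  · rw [hC.interior_nonempty_iff_affineSpan_eq_top] at hInt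
    obtain ⟨p, hp⟩ := hne
    have hdir : (affineSpan ℝ C).direction < ⊤ := by
      refine lt_top_iff_ne_top.2 fun h => hInt ?_
      rwa [AffineSubspace.direction_eq_top_iff_of_nonempty ⟨p, subset_affineSpan ℝ C hp⟩] at h
    obtain ⟨l, hl, hker⟩ := Submodule.exists_le_ker_of_lt_top _ hdir
    have hconst : ∀ a ∈ C, l a = l p := fun a ha => by
      have h : l (a - p) = 0 := hker (AffineSubspace.vsub_mem_direction
        (subset_affineSpan ℝ C ha) (subset_affineSpan ℝ C hp))
      rwa [map_sub, sub_eq_zero] at h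
    have hL : LinearMap.toContinuousLinearMap l ≠ 0 := by simpa using hl
    rcases le_total (l p) (l z) with h | h
    · exact ⟨LinearMap.toContinuousLinearMap l, hL, fun a ha => by simpa [hconst a ha] using h⟩
    · exact ⟨-LinearMap.toContinuousLinearMap l, neg_ne_zero.2 hL,
        fun a ha => by simpa [hconst a ha] using h⟩

/-- In finite dimension, the barycenter of a probability measure carried by a convex set lies in
that set, without any closedness or measurability assumption on the set. -/
theorem Convex.integral_mem_of_finiteDimensional {Ω : Type*} [MeasurableSpace Ω] {γ : Measure Ω}
    [IsProbabilityMeasure γ] {E : Type*} [NormedAddCommGroup E] [NormedSpace ℝ E]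
    [FiniteDimensional ℝ E] {C : Set E} (hC : Convex ℝ C) {Φ : Ω → E}
    (hΦ : Integrable Φ γ) (hmem : ∀ᵐ ω ∂γ, Φ ω ∈ C) : ∫ ω, Φ ω ∂γ ∈ C := by
  induction hn : Module.finrank ℝ E using Nat.strong_induction_on generalizing E with
  | _ n ih =>
  by_contra hz
  set z := ∫ ω, Φ ω ∂γ with hzdef
  obtain ⟨l, hl0, hl⟩ := exists_dual_forall_le_of_notMem hC hz
    (hmem.exists.elim fun _ hω => ⟨_, hω⟩)
  have hlΦ : ∀ᵐ ω ∂γ, l (Φ ω) = l z := by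
    have hInt : Integrable (fun ω => l z - l (Φ ω)) γ :=
      (integrable_const _).sub (l.integrable_comp hΦ)
    have h0 : ∫ ω, (l z - l (Φ ω)) ∂γ = 0 := by
      rw [integral_sub (integrable_const _) (l.integrable_comp hΦ), l.integral_comp_comm hΦ]
      simp [hzdef]
    rw [integral_eq_zero_iff_of_nonneg_ae
      (hmem.mono fun ω hω => sub_nonneg.2 (hl _ hω)) hInt] at h0
    filter_upwards [h0] with ω hω
    exact (sub_eq_zero.1 hω).symm
  obtain ⟨v, hv⟩ : ∃ v, l v = 1 := by
    obtain ⟨w, hw⟩ : ∃ w, l w ≠ 0 := by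
      by_contra! h
      exact hl0 (ContinuousLinearMap.ext h)
    exact ⟨(l w)⁻¹ • w, by simp [hw]⟩
  let K : Submodule ℝ E := LinearMap.ker (l : E →ₗ[ℝ] ℝ)
  let P : E →L[ℝ] K := (ContinuousLinearMap.id ℝ E - l.smulRight v).codRestrict K
    (fun x => by simp [K, hv])
  have hP : ∀ x, l x = 0 → (P x : E) = x := fun x hx => by simp [P, hx]
  have hlt : Module.finrank ℝ K < n := by
    rw [← hn]
    refine Submodule.finrank_lt fun h => ?_
    have : v ∈ K := h ▸ Submodule.mem_top
    simp [K, hv] at this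
  have hconv : Convex ℝ {w : K | (w : E) + z ∈ C} := by
    have := (hC.translate_preimage_left z).linear_preimage K.subtype
    simpa [Set.preimage] using this
  have hInt : Integrable (fun ω => Φ ω - z) γ := hΦ.sub (integrable_const z)
  have key := ih _ hlt hconv (Φ := fun ω => P (Φ ω - z)) (P.integrable_comp hInt) (by
    filter_upwards [hlΦ, hmem] with ω h1 h2
    rwa [hP (Φ ω - z) (by simp [h1]), sub_add_cancel]) rfl
  rw [P.integral_comp_comm hInt, integral_sub hΦ (integrable_const z)] at key
  simp only [integral_const, probReal_univ, one_smul, ← hzdef, sub_self, map_zero,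
    Set.mem_ofPred_eq, ZeroMemClass.coe_zero, zero_add] at key
  exact hz key

/-- A probability measure can be replaced by a discrete one carried by at most `card J + 1` points
without changing the integrals of the finitely many integrable functions `F j`. -/
theorem exists_discrete_weights_of_integrable {Ω J : Type*} [MeasurableSpace Ω] [Fintype J]
    {γ : Measure Ω} [IsProbabilityMeasure γ] {F : J → Ω → ℝ} (hF : ∀ j, Integrable (F j) γ)
    {n : ℕ} (hn : Fintype.card J + 1 ≤ n) :
    ∃ (w : Fin n → ℝ) (x : Fin n → Ω), (∀ k, 0 ≤ w k) ∧ ∑ k, w k = 1 ∧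
      ∀ j, ∑ k, w k * F j (x k) = ∫ ω, F j ω ∂γ := by
  classical
  set Φ : Ω → J → ℝ := fun ω j => F j ω
  have hΦ : Integrable Φ γ := Integrable.of_eval hF
  have hmem := (convex_convexHull ℝ (Set.range Φ)).integral_mem_of_finiteDimensional hΦ
    (Filter.Eventually.of_forall fun ω => subset_convexHull ℝ _ ⟨ω, rfl⟩)
  obtain ⟨ι, _, z, w, hz, haff, hw, hw1, hsum⟩ := eq_pos_convex_span_of_mem_convexHull hmem
  have hcard : Fintype.card ι ≤ Fintype.card (Fin n) := by
    have h1 := haff.card_le_finrank_succ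
    have h2 := (vectorSpan ℝ (Set.range z)).finrank_le
    rw [Module.finrank_fintype_fun_eq_card] at h2
    rw [Fintype.card_fin]
    omega
  obtain ⟨e⟩ := Function.Embedding.nonempty_of_card_le hcard
  choose y hy using fun i => hz ⟨i, rfl⟩
  obtain ⟨ω₀⟩ : Nonempty Ω := nonempty_of_isProbabilityMeasure γ
  have key : ∀ G : Ω → ℝ, ∑ k, Function.extend e w 0 k * G (Function.extend e y (fun _ => ω₀) k)
      = ∑ i, w i * G (y i) := fun G => by
    refine (Fintype.sum_of_injective e e.injective _ _ (fun k hk => ?_) fun i => ?_).symm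
    · rw [Function.extend_apply' _ _ _ (fun ⟨i, hi⟩ => hk ⟨i, hi⟩)]
      simp
    · simp [e.injective.extend_apply]
  refine ⟨Function.extend e w 0, Function.extend e y fun _ => ω₀, fun k => ?_, ?_, fun j => ?_⟩
  · by_cases hk : ∃ i, e i = k
    · obtain ⟨i, rfl⟩ := hk
      rw [e.injective.extend_apply]
      exact (hw i).le
    · simp [Function.extend_apply' _ _ _ hk]
  · simpa [hw1] using key 1
  · rw [key, ← eval_integral hF, ← hsum]
    simp [Finset.sum_apply, ← hy, Φ]

/-- Atoms of zero weight can be removed from a finite convex combination. -/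
theorem exists_pos_weights {n : ℕ} {Ω : Type*} {w : Fin n → ℝ} (x : Fin n → Ω)
    (hw : ∀ k, 0 ≤ w k) (hw1 : ∑ k, w k = 1) :
    ∃ (q : ℕ) (α : Fin q → ℝ) (y : Fin q → Ω), 1 ≤ q ∧ q ≤ n ∧ (∀ k, 0 < α k) ∧ ∑ k, α k = 1 ∧
      ∀ F : Ω → ℝ, ∑ k, α k * F (y k) = ∑ k, w k * F (x k) := by
  classical
  let S := {k : Fin n // w k ≠ 0}
  let e : Fin (Fintype.card S) ≃ S := (Fintype.equivFin S).symm
  have key : ∀ F : Ω → ℝ, ∑ k, w (e k) * F (x (e k)) = ∑ k, w k * F (x k) := fun F => by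
    refine Fintype.sum_of_injective (fun k => (e k : Fin n))
      (Subtype.val_injective.comp e.injective) _ _ (fun k hk => ?_) fun _ => rfl
    by_contra hne
    exact hk ⟨e.symm ⟨k, left_ne_zero_of_mul hne⟩, by simp⟩
  have hsum : ∑ k, w (e k) = 1 := by simpa [hw1] using key 1
  refine ⟨Fintype.card S, fun k => w (e k), fun k => x (e k), ?_, ?_,
    fun k => (hw _).lt_of_ne (e k).2.symm, hsum, key⟩
  · by_contra! h
    have : IsEmpty (Fin (Fintype.card S)) := by
      rw [Nat.lt_one_iff.1 h]
      infer_instance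
    simp at hsum
  · exact (Fintype.card_subtype_le _).trans_eq (Fintype.card_fin n)

theorem integrable_sum_ofReal_smul_dirac {Ω κ : Type*} [MeasurableSpace Ω]
    [MeasurableSingletonClass Ω] [Fintype κ] (α : κ → ℝ) (x : κ → Ω) (F : Ω → ℝ) :
    Integrable F (∑ k, ENNReal.ofReal (α k) • Measure.dirac (x k)) :=
  integrable_finsetSum_measure.2 fun _ _ =>
    (integrable_dirac (by simp)).smul_measure ENNReal.ofReal_ne_top

theorem integral_sum_ofReal_smul_dirac {Ω κ : Type*} [MeasurableSpace Ω]
    [MeasurableSingletonClass Ω] [Fintype κ] {α : κ → ℝ} (hα : ∀ k, 0 ≤ α k) (x : κ → Ω)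
    (F : Ω → ℝ) :
    ∫ ω, F ω ∂(∑ k, ENNReal.ofReal (α k) • Measure.dirac (x k)) = ∑ k, α k * F (x k) := by
  rw [integral_finsetSum_measure fun _ _ =>
    (integrable_dirac (by simp)).smul_measure ENNReal.ofReal_ne_top]
  refine Finset.sum_congr rfl fun k _ => ?_
  rw [integral_smul_measure, integral_dirac, ENNReal.toReal_ofReal (hα k), smul_eq_mul]

theorem isProbabilityMeasure_sum_ofReal_smul_dirac {Ω κ : Type*} [MeasurableSpace Ω] [Fintype κ]
    {α : κ → ℝ} (hα : ∀ k, 0 ≤ α k) (hα1 : ∑ k, α k = 1) (x : κ → Ω) :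
    IsProbabilityMeasure (∑ k, ENNReal.ofReal (α k) • Measure.dirac (x k)) :=
  ⟨by simp [← ENNReal.ofReal_sum_of_nonneg fun k _ => hα k, hα1]⟩

theorem LowerSemicontinuousOn.continuousOn_mul {A : Type*} [TopologicalSpace A] {S : Set A}
    {a b : A → ℝ} (ha : ContinuousOn a S) (ha0 : ∀ p ∈ S, 0 ≤ a p)
    (hb : LowerSemicontinuousOn b S) (hb0 : ∀ p ∈ S, 0 ≤ b p) :
    LowerSemicontinuousOn (fun p => a p * b p) S := by
  intro p hp y hy
  rcases lt_or_ge y 0 with hy0 | hy0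
  · filter_upwards [self_mem_nhdsWithin] with p' hp'
    exact hy0.trans_le (mul_nonneg (ha0 _ hp') (hb0 _ hp'))
  · have hap : 0 < a p := (ha0 p hp).lt_of_ne fun h => by
      simp only [← h, zero_mul] at hy
      exact hy.not_ge hy0
    obtain ⟨s, hs1, hs2⟩ := exists_between ((div_lt_iff₀' hap).2 hy)
    have h1 : ∀ᶠ p' in nhdsWithin p S, y < a p' * s :=
      ((ha p hp).mul_const s).eventually_const_lt ((div_lt_iff₀' hap).1 hs1)
    filter_upwards [h1, hb p hp s hs2, self_mem_nhdsWithin] with p' h1 h2 h3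
    exact h1.trans_le (mul_le_mul_of_nonneg_left h2.le (ha0 _ h3))

theorem lowerSemicontinuousOn_sum_weights {A : Type*} [TopologicalSpace A] {n : ℕ} {f : A → ℝ}
    (hf : LowerSemicontinuous f) {c : ℝ} (hc : ∀ x, c ≤ f x) :
    LowerSemicontinuousOn (fun p : (Fin n → ℝ) × (Fin n → A) => ∑ k, p.1 k * f (p.2 k))
      (stdSimplex ℝ (Fin n) ×ˢ Set.univ) := by
  refine lowerSemicontinuousOn_sum fun k _ => ?_
  have hfc : LowerSemicontinuous fun x => f x - c := by
    simpa [sub_eq_add_neg] using hf.add (lowerSemicontinuous_const (z := -c))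
  have h1 : LowerSemicontinuousOn (fun p : (Fin n → ℝ) × (Fin n → A) => p.1 k * (f (p.2 k) - c))
      (stdSimplex ℝ (Fin n) ×ˢ Set.univ) :=
    .continuousOn_mul (by fun_prop) (fun p hp => hp.1.1 k)
      ((hfc.comp (g := fun p : (Fin n → ℝ) × (Fin n → A) => p.2 k)
        (by fun_prop)).lowerSemicontinuousOn _)
      fun p _ => sub_nonneg.2 (hc _)
  have h2 : ContinuousOn (fun p : (Fin n → ℝ) × (Fin n → A) => p.1 k * c)
      (stdSimplex ℝ (Fin n) ×ˢ Set.univ) := by fun_prop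
  simpa only [← mul_add, sub_add_cancel] using h1.add h2.lowerSemicontinuousOn

/-- Moment-constrained minimization over convex combinations of `n` Dirac masses has a solution on
a compact space. -/
theorem exists_isMin_weights {A J : Type*} [TopologicalSpace A] [CompactSpace A] {n : ℕ}
    {f : A → ℝ} (hf : LowerSemicontinuous f) {F : J → A → ℝ} (hF : ∀ j, Continuous (F j))
    {b : J → ℝ}
    (hne : ∃ (w : Fin n → ℝ) (x : Fin n → A), (∀ k, 0 ≤ w k) ∧ ∑ k, w k = 1 ∧
      ∀ j, ∑ k, w k * F j (x k) = b j) :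
    ∃ (w : Fin n → ℝ) (x : Fin n → A), ((∀ k, 0 ≤ w k) ∧ ∑ k, w k = 1 ∧
      ∀ j, ∑ k, w k * F j (x k) = b j) ∧
      ∀ (w' : Fin n → ℝ) (x' : Fin n → A), (∀ k, 0 ≤ w' k) → ∑ k, w' k = 1 →
        (∀ j, ∑ k, w' k * F j (x' k) = b j) → ∑ k, w k * f (x k) ≤ ∑ k, w' k * f (x' k) := by
  obtain ⟨w₀, x₀, hw₀, hw₁, hb₀⟩ := hne
  obtain ⟨c, hc⟩ : ∃ c, ∀ x, c ≤ f x := by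
    rcases isEmpty_or_nonempty A with _ | _
    · exact ⟨0, isEmptyElim⟩
    · obtain ⟨a, -, ha⟩ := (hf.lowerSemicontinuousOn Set.univ).exists_isMinOn
        Set.univ_nonempty isCompact_univ
      exact ⟨f a, fun x => ha (Set.mem_univ x)⟩
  let S : Set ((Fin n → ℝ) × (Fin n → A)) := stdSimplex ℝ (Fin n) ×ˢ Set.univ
  let T : Set ((Fin n → ℝ) × (Fin n → A)) := {p | ∀ j, ∑ k, p.1 k * F j (p.2 k) = b j}
  have hT : IsClosed T := by
    simp only [T, Set.ofPred_forall]
    exact isClosed_iInter fun j => isClosed_eq (by fun_prop) continuous_const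
  have hST : IsCompact (S ∩ T) := ((isCompact_stdSimplex ℝ _).prod isCompact_univ).inter_right hT
  have hne : (S ∩ T).Nonempty := ⟨(w₀, x₀), ⟨⟨hw₀, hw₁⟩, trivial⟩, hb₀⟩
  obtain ⟨⟨w, x⟩, hp, hmin⟩ := ((lowerSemicontinuousOn_sum_weights hf hc).mono
    (Set.inter_subset_left (t := T))).exists_isMinOn hne hST
  exact ⟨w, x, ⟨hp.1.1.1, hp.1.1.2, hp.2⟩, fun w' x' h0 h1 hb =>
    hmin (a := (w', x')) ⟨⟨⟨h0, h1⟩, trivial⟩, hb⟩⟩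

section RelaxedCoupling

variable {N : ℕ} {X : Fin N → Type*} [∀ i, MeasurableSpace (X i)] [∀ i, MetricSpace (X i)]
  {m : Fin N → ℕ} {μ : ∀ i, Measure (X i)} {g : ∀ i, Fin (m i) → X i → ℝ}

theorem IsRelaxedCoupling.integrable {γ : Measure (∀ i, X i)}
    (hγ : IsRelaxedCoupling γ μ fun i => Set.range (g i)) (i : Fin N) (j : Fin (m i)) :
    Integrable (fun x => g i j (x i)) γ :=
  ((hγ.2 i).2.2 _ ⟨j, rfl⟩).1.comp_measurable (measurable_pi_apply i)

theorem IsRelaxedCoupling.integral_eq {γ : Measure (∀ i, X i)}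
    (hγ : IsRelaxedCoupling γ μ fun i => Set.range (g i)) (i : Fin N) (j : Fin (m i)) :
    ∫ x, g i j (x i) ∂γ = ∫ y, g i j y ∂μ i := by
  have h := (hγ.2 i).2.2 _ ⟨j, rfl⟩
  rw [← h.2, integral_map (measurable_pi_apply i).aemeasurable h.1.aestronglyMeasurable]

theorem isRelaxedCoupling_sum_dirac [∀ i, PolishSpace (X i)] [∀ i, BorelSpace (X i)]
    {κ : Type*} [Fintype κ] {α : κ → ℝ} (hα : ∀ k, 0 ≤ α k) (hα1 : ∑ k, α k = 1)
    (x : κ → ∀ i, X i)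
    (hmom : ∀ i j, ∑ k, α k * g i j (x k i) = ∫ y, g i j y ∂μ i) :
    IsRelaxedCoupling (∑ k, ENNReal.ofReal (α k) • Measure.dirac (x k)) μ
      fun i => Set.range (g i) := by
  refine ⟨isProbabilityMeasure_sum_ofReal_smul_dirac hα hα1 x, fun i => ?_⟩
  have hmap : (∑ k, ENNReal.ofReal (α k) • Measure.dirac (x k)).map (fun x => x i)
      = ∑ k, ENNReal.ofReal (α k) • Measure.dirac (x k i) := by
    rw [Measure.map_finset_sum (measurable_pi_apply i).aemeasurable]
    refine Finset.sum_congr rfl fun k _ => ?_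
    rw [Measure.map_smul, Measure.map_dirac' (measurable_pi_apply i)]
  rw [hmap]
  have hne : Nonempty κ := by
    by_contra h
    rw [not_nonempty_iff] at h
    simp at hα1
  refine ⟨isProbabilityMeasure_sum_ofReal_smul_dirac hα hα1 _,
    ⟨x hne.some i, integrable_sum_ofReal_smul_dirac _ _ _⟩, ?_⟩
  rintro _ ⟨j, rfl⟩
  exact ⟨integrable_sum_ofReal_smul_dirac _ _ _,
    (integral_sum_ofReal_smul_dirac hα _ _).trans (hmom i j)⟩

theorem isRelaxedCoupling_pi [∀ i, IsProbabilityMeasure (μ i)]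
    (hμP1 : ∀ i, HasFiniteFirstMoment (μ i)) (hg_int : ∀ i j, Integrable (g i j) (μ i)) :
    IsRelaxedCoupling (Measure.pi μ) μ fun i => Set.range (g i) := by
  refine ⟨inferInstance, fun i => ?_⟩
  rw [(measurePreserving_eval μ i).map_eq]
  refine ⟨inferInstance, hμP1 i, ?_⟩
  rintro _ ⟨j, rfl⟩
  exact ⟨hg_int i j, rfl⟩

end RelaxedCoupling


/-- **Sparsely supported approximate optimizers of the relaxed MMOT problem**
(Proposition 2.8).  (i) For every `ε₀ > 0` there is an `ε₀`-optimal solution of the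
relaxed problem which is a discrete measure supported on at most `m + 2` points, where
`m = Σ_i m_i`.  (ii) If moreover each `X_i` is compact and all test functions are
continuous, there is such a discrete measure attaining the infimum. -/
theorem relaxed_mmot_sparse_optimizers {N : ℕ} {X : Fin N → Type*}
    [∀ i, MeasurableSpace (X i)] [∀ i, MetricSpace (X i)]
    [∀ i, PolishSpace (X i)] [∀ i, BorelSpace (X i)]
    (μ : ∀ i, Measure (X i)) (hμprob : ∀ i, IsProbabilityMeasure (μ i))
    (hμP1 : ∀ i, HasFiniteFirstMoment (μ i))
    (f : (∀ i, X i) → ℝ)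
    (hf_lsc : LowerSemicontinuous f)
    (hf_lb : ∃ h : ∀ i, X i → ℝ, (∀ i, UpperSemicontinuous (h i)) ∧
      (∀ i, Integrable (h i) (μ i)) ∧ ∀ x : ∀ i, X i, (∑ i, h i (x i)) ≤ f x)
    (m : Fin N → ℕ) (g : ∀ i, Fin (m i) → X i → ℝ)
    (hg_meas : ∀ i j, Measurable (g i j))
    (hg_int : ∀ i j, Integrable (g i j) (μ i)) :
    (∀ ε₀ : ℝ, 0 < ε₀ →
      ∃ (q : ℕ) (α : Fin q → ℝ) (x : Fin q → ∀ i, X i),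
        1 ≤ q ∧ q ≤ (∑ i, m i) + 2 ∧ (∀ k, 0 < α k) ∧ (∑ k, α k) = 1 ∧
        IsRelaxedCoupling (∑ k : Fin q, ENNReal.ofReal (α k) • Measure.dirac (x k)) μ
          (fun i => Set.range (g i)) ∧
        (∫ y, f y ∂(∑ k : Fin q, ENNReal.ofReal (α k) • Measure.dirac (x k))) ≤
          sInf (OTValues f {γ | IsRelaxedCoupling γ μ (fun i => Set.range (g i))}) + ε₀) ∧
    ((∀ i, CompactSpace (X i)) → (∀ i j, Continuous (g i j)) →
      ∃ (q : ℕ) (α : Fin q → ℝ) (x : Fin q → ∀ i, X i),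
        1 ≤ q ∧ q ≤ (∑ i, m i) + 2 ∧ (∀ k, 0 < α k) ∧ (∑ k, α k) = 1 ∧
        IsRelaxedCoupling (∑ k : Fin q, ENNReal.ofReal (α k) • Measure.dirac (x k)) μ
          (fun i => Set.range (g i)) ∧
        Integrable f (∑ k : Fin q, ENNReal.ofReal (α k) • Measure.dirac (x k)) ∧
        (∫ y, f y ∂(∑ k : Fin q, ENNReal.ofReal (α k) • Measure.dirac (x k))) =
          sInf (OTValues f {γ | IsRelaxedCoupling γ μ (fun i => Set.range (g i))})) := by
  have : ∀ i, IsProbabilityMeasure (μ i) := hμprob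
  let J := Σ i, Fin (m i)
  let F : J → (∀ i, X i) → ℝ := fun p x => g p.1 p.2 (x p.1)
  let b : J → ℝ := fun p => ∫ y, g p.1 p.2 y ∂μ p.1
  set V := OTValues f {γ | IsRelaxedCoupling γ μ fun i => Set.range (g i)}
  have hcard : Fintype.card J = ∑ i, m i := by simp [J]
  have hpi := isRelaxedCoupling_pi hμP1 hg_int
  have hmemV : ∀ {q : ℕ} {α : Fin q → ℝ} {x : Fin q → ∀ i, X i}, (∀ k, 0 ≤ α k) →
      ∑ k, α k = 1 → (∀ j, ∑ k, α k * F j (x k) = b j) → ∑ k, α k * f (x k) ∈ V :=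
    fun {_ _ x} hα hα1 hmom => ⟨_, isRelaxedCoupling_sum_dirac hα hα1 x fun i j => hmom ⟨i, j⟩,
      integrable_sum_ofReal_smul_dirac _ _ _, integral_sum_ofReal_smul_dirac hα _ _⟩
  obtain ⟨w₀, x₀, hw₀, hw₀1, hmom₀⟩ : ∃ (w : Fin ((∑ i, m i) + 2) → ℝ)
      (x : Fin ((∑ i, m i) + 2) → ∀ i, X i), (∀ k, 0 ≤ w k) ∧ ∑ k, w k = 1 ∧
      ∀ j, ∑ k, w k * F j (x k) = b j := by
    obtain ⟨w, x, h0, h1, h2⟩ := exists_discrete_weights_of_integrable (γ := Measure.pi μ) (F := F)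
      (fun j => hpi.integrable j.1 j.2) (n := (∑ i, m i) + 2) (by omega)
    exact ⟨w, x, h0, h1, fun j => (h2 j).trans (hpi.integral_eq j.1 j.2)⟩
  have hV : V.Nonempty := ⟨_, hmemV hw₀ hw₀1 hmom₀⟩
  have hreduce : ∀ r ∈ V, ∃ (w : Fin ((∑ i, m i) + 2) → ℝ)
      (x : Fin ((∑ i, m i) + 2) → ∀ i, X i), (∀ k, 0 ≤ w k) ∧ ∑ k, w k = 1 ∧
      (∀ j, ∑ k, w k * F j (x k) = b j) ∧ ∑ k, w k * f (x k) = r := by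
    rintro r ⟨γ, hγ, hfγ, rfl⟩
    have := hγ.1
    obtain ⟨w, x, h0, h1, h2⟩ := exists_discrete_weights_of_integrable (γ := γ)
      (F := fun o : Option J => o.elim f F)
      (Option.rec hfγ fun j => hγ.integrable j.1 j.2) (n := (∑ i, m i) + 2)
      (by rw [Fintype.card_option]; omega)
    exact ⟨w, x, h0, h1, fun j => (h2 (some j)).trans (hγ.integral_eq j.1 j.2), h2 none⟩
  constructor
  · intro ε₀ hε₀
    obtain ⟨r, hrV, hr⟩ : ∃ r ∈ V, r < sInf V + ε₀ :=
      Real.lt_sInf_add_pos hV hε₀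
    obtain ⟨w, x, hw, hw1, hmom, hval⟩ := hreduce r hrV
    obtain ⟨q, α, y, hq1, hqm, hα, hα1, hαF⟩ := exists_pos_weights x hw hw1
    refine ⟨q, α, y, hq1, hqm, hα, hα1, isRelaxedCoupling_sum_dirac (fun k => (hα k).le) hα1 y
      fun i j => (hαF (F ⟨i, j⟩)).trans (hmom ⟨i, j⟩), ?_⟩
    rw [integral_sum_ofReal_smul_dirac fun k => (hα k).le, hαF, hval]
    exact hr.le
  · intro hcomp hcont
    obtain ⟨w, x, ⟨hw, hw1, hmom⟩, hmin⟩ := exists_isMin_weights hf_lsc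
      (F := F) (fun j => (hcont j.1 j.2).comp (continuous_apply j.1)) ⟨w₀, x₀, hw₀, hw₀1, hmom₀⟩
    have hleast : IsLeast V (∑ k, w k * f (x k)) := by
      refine ⟨hmemV hw hw1 hmom, fun r hr => ?_⟩
      obtain ⟨w', x', hw', hw1', hmom', rfl⟩ := hreduce r hr
      exact hmin w' x' hw' hw1' hmom'
    obtain ⟨q, α, y, hq1, hqm, hα, hα1, hαF⟩ := exists_pos_weights x hw hw1
    refine ⟨q, α, y, hq1, hqm, hα, hα1, isRelaxedCoupling_sum_dirac (fun k => (hα k).le) hα1 y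
      fun i j => (hαF (F ⟨i, j⟩)).trans (hmom ⟨i, j⟩), integrable_sum_ofReal_smul_dirac _ _ _, ?_⟩
    rw [integral_sum_ofReal_smul_dirac fun k => (hα k).le, hαF, hleast.csInf_eq]

end
end

section
/- Under the standing hypotheses, the infimum of ∫_X f dμ over μ ∈ Γ([μ_1]_{G_1},...,[μ_N]_{G_N}) is not equal to −∞. -/
open MeasureTheory

noncomputable section

/-- `span_1(G)`: finite linear combinations of functions in `G` plus a constant. -/
def Span1 {Y : Type*} (G : Set (Y → ℝ)) : Set (Y → ℝ) :=
  {h | ∃ (k : ℕ) (c : ℝ) (a : Fin k → ℝ) (gs : Fin k → Y → ℝ),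
    (∀ j, gs j ∈ G) ∧ h = fun y => c + ∑ j, a j * gs j y}

/-- The `W_1`-radius `W̄_{1,μ}([μ]_G) = sup_{ν ∈ [μ]_G} W_1(μ, ν)` of a moment set. -/
def W1rad {Y : Type*} [MeasurableSpace Y] [PseudoMetricSpace Y]
    (μ : Measure Y) (G : Set (Y → ℝ)) : ℝ :=
  sSup ((fun ν => W1 μ ν) '' MomentSet μ G)

/-- The order-1 Wasserstein distance on the product space equipped with the
1-product metric `d(x, y) = Σ_i d_i(x_i, y_i)`. -/
def W1prod {N : ℕ} {X : Fin N → Type*} [∀ i, MeasurableSpace (X i)]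
    [∀ i, MetricSpace (X i)] (μ ν : Measure (∀ i, X i)) : ℝ :=
  sInf {r : ℝ | ∃ γ : Measure ((∀ i, X i) × (∀ i, X i)), IsProbabilityMeasure γ ∧
    γ.map Prod.fst = μ ∧ γ.map Prod.snd = ν ∧
    Integrable (fun q => ∑ i, dist (q.1 i) (q.2 i)) γ ∧
    (∫ q, ∑ i, dist (q.1 i) (q.2 i) ∂γ) = r}

/-- Functions in `Span1 G` are integrable, with the same integral, under every measure of the
moment set `MomentSet μ G`. -/
theorem MomentSet.integrable_and_integral_eq_of_mem_span1 {Y : Type*} [MeasurableSpace Y]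
    [PseudoMetricSpace Y] {μ ν : Measure Y} [IsProbabilityMeasure μ] {G : Set (Y → ℝ)}
    (hG : ∀ g ∈ G, Integrable g μ) (hν : ν ∈ MomentSet μ G) {h : Y → ℝ} (hh : h ∈ Span1 G) :
    Integrable h ν ∧ ∫ y, h y ∂ν = ∫ y, h y ∂μ := by
  obtain ⟨k, c, a, gs, hgs, rfl⟩ := hh
  obtain ⟨hprob, -, hmom⟩ := hν
  have hiν : ∀ j, Integrable (fun y => a j * gs j y) ν :=
    fun j => (hmom _ (hgs j)).1.const_mul _
  have hiμ : ∀ j, Integrable (fun y => a j * gs j y) μ :=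
    fun j => (hG _ (hgs j)).const_mul _
  refine ⟨(integrable_const c).add (integrable_finsetSum _ fun j _ => hiν j), ?_⟩
  rw [integral_add (integrable_const c) (integrable_finsetSum _ fun j _ => hiν j),
    integral_add (integrable_const c) (integrable_finsetSum _ fun j _ => hiμ j),
    integral_finsetSum _ fun j _ => hiν j, integral_finsetSum _ fun j _ => hiμ j]
  simp [integral_const_mul, (hmom _ (hgs _)).2]

/-- Under a relaxed coupling, a sum of functions from the spans is integrable and its integral is
determined by the reference marginals. -/
theorem IsRelaxedCoupling.integrable_and_integral_sum_eq {N : ℕ} {X : Fin N → Type*}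
    [∀ i, MeasurableSpace (X i)] [∀ i, MetricSpace (X i)]
    {γ : Measure (∀ i, X i)} {μ : ∀ i, Measure (X i)} [∀ i, IsProbabilityMeasure (μ i)]
    {G : ∀ i, Set (X i → ℝ)} (hγ : IsRelaxedCoupling γ μ G)
    (hG : ∀ i, ∀ g ∈ G i, Integrable g (μ i)) {h : ∀ i, X i → ℝ} (hh : ∀ i, h i ∈ Span1 (G i)) :
    Integrable (fun x => ∑ i, h i (x i)) γ ∧
      ∫ x, ∑ i, h i (x i) ∂γ = ∑ i, ∫ t, h i t ∂(μ i) := by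
  have key := fun i =>
    MomentSet.integrable_and_integral_eq_of_mem_span1 (hG i) (hγ.2 i) (hh i)
  have hint : ∀ i, Integrable (fun x : ∀ i, X i => h i (x i)) γ :=
    fun i => (key i).1.comp_measurable (measurable_pi_apply i)
  refine ⟨integrable_finsetSum _ fun i _ => hint i, ?_⟩
  rw [integral_finsetSum _ fun i _ => hint i]
  refine Finset.sum_congr rfl fun i _ => ?_
  rw [← (key i).2, integral_map (measurable_pi_apply i).aemeasurable (key i).1.aestronglyMeasurable]

/-- **Theorem 2.10 (ii)**: under the standing hypotheses, the infimum of `∫ f dμ` over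
`μ ∈ Γ([μ_1]_{G_1}, …, [μ_N]_{G_N})` is not `−∞`, i.e. the set of attained values is
bounded from below. -/
theorem relaxed_mmot_bounded_below {N : ℕ} {X : Fin N → Type*}
    [∀ i, MeasurableSpace (X i)] [∀ i, MetricSpace (X i)]
    [∀ i, PolishSpace (X i)] [∀ i, BorelSpace (X i)]
    (μ : ∀ i, Measure (X i)) (hμprob : ∀ i, IsProbabilityMeasure (μ i))
    (hμP1 : ∀ i, HasFiniteFirstMoment (μ i))
    (f : (∀ i, X i) → ℝ)
    (hf_lsc : LowerSemicontinuous f)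
    (hf_lb : ∃ h : ∀ i, X i → ℝ, (∀ i, UpperSemicontinuous (h i)) ∧
      (∀ i, Integrable (h i) (μ i)) ∧ ∀ x : ∀ i, X i, (∑ i, h i (x i)) ≤ f x)
    (G : ∀ i, Set (X i → ℝ))
    (hG : ∀ i, ∀ g ∈ G i, Measurable g ∧ Integrable g (μ i))
    (Lf : ℝ) (hLf : 0 < Lf)
    (D : Set (∀ i, X i)) (hD : MeasurableSet D)
    (fl fu : ∀ i, X i → ℝ)
    (hfl_meas : ∀ i, Measurable (fl i)) (hfu_meas : ∀ i, Measurable (fu i))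
    (hfl_int : ∀ i, Integrable (fl i) (μ i)) (hfu_int : ∀ i, Integrable (fu i) (μ i))
    (hfl_span : ∀ i, fl i ∈ Span1 (G i))
    (hflu : ∀ i, ∀ t : X i, fl i t ≤ fu i t)
    (hLip : ∀ x ∈ D, ∀ y ∈ D, |f x - f y| ≤ Lf * ∑ i, dist (x i) (y i))
    (hsand : ∀ x : ∀ i, X i,
      (∑ i, fl i (x i)) ≤ Set.indicator Dᶜ f x ∧
      Set.indicator Dᶜ f x ≤ ∑ i, fu i (x i))
    (hdom : ∃ xhat : ∀ i, X i, xhat ∈ D ∧ ∃ h : ∀ i, X i → ℝ,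
      (∀ i, h i ∈ Span1 (G i)) ∧ ∀ i, ∀ t : X i, dist (xhat i) t ≤ h i t)
    :
    BddBelow (OTValues f {γ : Measure (∀ i, X i) | IsRelaxedCoupling γ μ G}) := by
  obtain ⟨xhat, hxD, h, hh_span, hh⟩ := hdom
  have hGint : ∀ i, ∀ g ∈ G i, Integrable g (μ i) := fun i g hg => (hG i g hg).2
  refine ⟨(∑ i, ∫ t, fl i t ∂(μ i)) - |f xhat| - Lf * ∑ i, ∫ t, h i t ∂(μ i), ?_⟩
  rintro _ ⟨γ, hγ, hfγ, rfl⟩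
  have hprob : IsProbabilityMeasure γ := hγ.1
  obtain ⟨hfl_γ, hfl_eq⟩ := hγ.integrable_and_integral_sum_eq hGint hfl_span
  obtain ⟨hh_γ, hh_eq⟩ := hγ.integrable_and_integral_sum_eq hGint hh_span
  have hlower : ∀ x, (∑ i, fl i (x i)) - |f xhat| - Lf * ∑ i, h i (x i) ≤ f x := by
    intro x
    have hsum : ∑ i, dist (xhat i) (x i) ≤ ∑ i, h i (x i) :=
      Finset.sum_le_sum fun i _ => hh i (x i)
    have hdist : 0 ≤ ∑ i, dist (xhat i) (x i) := Finset.sum_nonneg fun i _ => dist_nonneg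
    have hmul := mul_le_mul_of_nonneg_left hsum hLf.le
    have hfl := (hsand x).1
    by_cases hx : x ∈ D
    · rw [Set.indicator_of_notMem (by simpa using hx)] at hfl
      linarith [le_abs_self (f xhat - f x), hLip xhat hxD x hx, neg_abs_le (f xhat)]
    · rw [Set.indicator_of_mem hx] at hfl
      linarith [mul_nonneg hLf.le hdist, abs_nonneg (f xhat)]
  have hc : Integrable (fun _ : ∀ i, X i => |f xhat|) γ := integrable_const _
  have hflc : Integrable (fun x => (∑ i, fl i (x i)) - |f xhat|) γ := hfl_γ.sub hc
  calc (∑ i, ∫ t, fl i t ∂(μ i)) - |f xhat| - Lf * ∑ i, ∫ t, h i t ∂(μ i)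
      = ∫ x, (∑ i, fl i (x i)) - |f xhat| - Lf * ∑ i, h i (x i) ∂γ := by
        rw [integral_sub hflc (hh_γ.const_mul Lf), integral_sub hfl_γ hc,
          integral_const_mul, hfl_eq, hh_eq]
        simp
    _ ≤ ∫ x, f x ∂γ := integral_mono (hflc.sub (hh_γ.const_mul Lf)) hfγ hlower

end
end

section
/- Under the standing hypotheses, for each i = 1,...,N the W_1-radius of the moment set is finite: W̄_{1,μ_i}([μ_i]_{G_i}) := sup_{ν ∈ [μ_i]_{G_i}} W_1(μ_i,ν) < ∞. -/
open MeasureTheory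

noncomputable section

/-- A finite first moment does not depend on the base point. -/
lemma HasFiniteFirstMoment.integrable_dist {Y : Type*} [MeasurableSpace Y] [PseudoMetricSpace Y]
    [OpensMeasurableSpace Y] {μ : Measure Y} [IsFiniteMeasure μ]
    (hμ : HasFiniteFirstMoment μ) (x₀ : Y) : Integrable (fun y => dist x₀ y) μ := by
  obtain ⟨y₀, hy₀⟩ := hμ
  refine ((integrable_const (dist x₀ y₀)).add hy₀).mono'
    (by fun_prop : Measurable fun y => dist x₀ y).aestronglyMeasurable (.of_forall fun y => ?_)
  rw [Real.norm_of_nonneg dist_nonneg]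
  exact dist_triangle _ _ _

/-- Functions in `Span1 G` are integrable against every measure in the moment set, with the same
integral as against the reference measure. -/
lemma MomentSet.integrable_and_integral_eq {Y : Type*} [MeasurableSpace Y] [PseudoMetricSpace Y]
    {μ ν : Measure Y} [IsProbabilityMeasure μ] {G : Set (Y → ℝ)}
    (hG : ∀ g ∈ G, Integrable g μ) (hν : ν ∈ MomentSet μ G) {h : Y → ℝ} (hh : h ∈ Span1 G) :
    Integrable h ν ∧ (∫ y, h y ∂ν) = ∫ y, h y ∂μ := by
  obtain ⟨hprob, -, hmom⟩ := hν
  obtain ⟨k, c, a, gs, hgs, rfl⟩ := hh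
  have hiν : ∀ j, Integrable (fun y => a j * gs j y) ν :=
    fun j => (hmom _ (hgs j)).1.const_mul _
  have hiμ : ∀ j, Integrable (fun y => a j * gs j y) μ := fun j => (hG _ (hgs j)).const_mul _
  have hsν := integrable_finsetSum Finset.univ fun j _ => hiν j
  have hsμ := integrable_finsetSum Finset.univ fun j _ => hiμ j
  refine ⟨(integrable_const c).add hsν, ?_⟩
  rw [integral_add (integrable_const c) hsν, integral_add (integrable_const c) hsμ,
    integral_finsetSum _ fun j _ => hiν j, integral_finsetSum _ fun j _ => hiμ j]
  simp [integral_const_mul, (hmom _ (hgs _)).2]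

/-- The product coupling bounds the Wasserstein distance by the sum of the first moments. -/
lemma W1_le_add_integral_dist {Y : Type*} [MeasurableSpace Y] [PseudoMetricSpace Y]
    [SecondCountableTopology Y] [OpensMeasurableSpace Y]
    {μ ν : Measure Y} [IsProbabilityMeasure μ] [IsProbabilityMeasure ν] {x₀ : Y}
    (hμ : Integrable (fun y => dist x₀ y) μ) (hν : Integrable (fun y => dist x₀ y) ν) :
    W1 μ ν ≤ (∫ y, dist x₀ y ∂μ) + ∫ y, dist x₀ y ∂ν := by
  have hadd : Integrable (fun q : Y × Y => dist x₀ q.1 + dist x₀ q.2) (μ.prod ν) :=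
    (hμ.comp_fst ν).add (hν.comp_snd μ)
  have hle : ∀ q : Y × Y, dist q.1 q.2 ≤ dist x₀ q.1 + dist x₀ q.2 :=
    fun q => dist_triangle_left _ _ _
  have hdist : Integrable (fun q : Y × Y => dist q.1 q.2) (μ.prod ν) :=
    hadd.mono' (by fun_prop : Measurable fun q : Y × Y => dist q.1 q.2).aestronglyMeasurable
      (.of_forall fun q => by rw [Real.norm_of_nonneg dist_nonneg]; exact hle q)
  calc W1 μ ν ≤ ∫ q, dist q.1 q.2 ∂(μ.prod ν) := by
        refine csInf_le ⟨0, ?_⟩ ⟨μ.prod ν, ⟨inferInstance, by simp, by simp⟩, hdist, rfl⟩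
        rintro r ⟨γ, -, -, rfl⟩
        exact integral_nonneg fun _ => dist_nonneg
    _ ≤ ∫ q : Y × Y, (dist x₀ q.1 + dist x₀ q.2) ∂(μ.prod ν) := integral_mono hdist hadd hle
    _ = (∫ y, dist x₀ y ∂μ) + ∫ y, dist x₀ y ∂ν := by
        rw [integral_add (hμ.comp_fst ν) (hν.comp_snd μ),
          integral_fun_fst (fun y => dist x₀ y), integral_fun_snd (fun y => dist x₀ y)]
        simp

/-- **Theorem 2.10 (iii)**: under the standing hypotheses, for each `i` the `W_1`-radius of
the moment set `[μ_i]_{G_i}` is finite, i.e. `sup_{ν ∈ [μ_i]_{G_i}} W_1(μ_i, ν) < ∞`. -/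
theorem momentset_W1_radius_finite {N : ℕ} {X : Fin N → Type*}
    [∀ i, MeasurableSpace (X i)] [∀ i, MetricSpace (X i)]
    [∀ i, PolishSpace (X i)] [∀ i, BorelSpace (X i)]
    (μ : ∀ i, Measure (X i)) (hμprob : ∀ i, IsProbabilityMeasure (μ i))
    (hμP1 : ∀ i, HasFiniteFirstMoment (μ i))
    (f : (∀ i, X i) → ℝ)
    (hf_lsc : LowerSemicontinuous f)
    (hf_lb : ∃ h : ∀ i, X i → ℝ, (∀ i, UpperSemicontinuous (h i)) ∧
      (∀ i, Integrable (h i) (μ i)) ∧ ∀ x : ∀ i, X i, (∑ i, h i (x i)) ≤ f x)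
    (G : ∀ i, Set (X i → ℝ))
    (hG : ∀ i, ∀ g ∈ G i, Measurable g ∧ Integrable g (μ i))
    (Lf : ℝ) (hLf : 0 < Lf)
    (D : Set (∀ i, X i)) (hD : MeasurableSet D)
    (fl fu : ∀ i, X i → ℝ)
    (hfl_meas : ∀ i, Measurable (fl i)) (hfu_meas : ∀ i, Measurable (fu i))
    (hfl_int : ∀ i, Integrable (fl i) (μ i)) (hfu_int : ∀ i, Integrable (fu i) (μ i))
    (hfl_span : ∀ i, fl i ∈ Span1 (G i))
    (hflu : ∀ i, ∀ t : X i, fl i t ≤ fu i t)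
    (hLip : ∀ x ∈ D, ∀ y ∈ D, |f x - f y| ≤ Lf * ∑ i, dist (x i) (y i))
    (hsand : ∀ x : ∀ i, X i,
      (∑ i, fl i (x i)) ≤ Set.indicator Dᶜ f x ∧
      Set.indicator Dᶜ f x ≤ ∑ i, fu i (x i))
    (hdom : ∃ xhat : ∀ i, X i, xhat ∈ D ∧ ∃ h : ∀ i, X i → ℝ,
      (∀ i, h i ∈ Span1 (G i)) ∧ ∀ i, ∀ t : X i, dist (xhat i) t ≤ h i t)
    :
    ∀ i, BddAbove ((fun ν => W1 (μ i) ν) '' MomentSet (μ i) (G i)) := by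
  intro i
  have := hμprob i
  obtain ⟨xhat, -, h, hspan, hdist⟩ := hdom
  refine ⟨(∫ y, dist (xhat i) y ∂(μ i)) + ∫ y, h i y ∂(μ i), ?_⟩
  rintro _ ⟨ν, hν, rfl⟩
  have := hν.1
  have hν_dist := hν.2.1.integrable_dist (xhat i)
  obtain ⟨hint, heq⟩ :=
    MomentSet.integrable_and_integral_eq (fun g hg => (hG i g hg).2) hν (hspan i)
  refine (W1_le_add_integral_dist ((hμP1 i).integrable_dist (xhat i)) hν_dist).trans ?_
  rw [← heq]
  gcongr
  exact hdist i

end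
end

section
/- Let the cost Assumption hold and let G_i = {g_{i,1},...,g_{i,m_i}} be finite sets of μ_i-integrable Borel functions, with m := Σ_i m_i and g, ḡ, K as in the LSIP setup. Suppose there exists at least one (y_0,y) ∈ ℝ×ℝ^m with y_0 + ⟨g(x),y⟩ ≤ f(x) for all x ∈ X, and suppose ḡ lies in the relative interior of K. Then strong duality holds: sup{ y_0 + ⟨ḡ,y⟩ : y_0 + ⟨g(x),y⟩ ≤ f(x) ∀x ∈ X } = inf{ ∫_X f dμ : μ ∈ Γ([μ_1]_{G_1},...,[μ_N]_{G_N}) }, and the supremum is attained by some (y_0*, y*). -/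
open MeasureTheory

noncomputable section

/-- The vector of test functions `g(x) ∈ ℝ^m`, `m = Σ_i m_i`, indexed by pairs `(i, j)`. -/
def gvec {N : ℕ} {X : Fin N → Type*} (m : Fin N → ℕ) (g : ∀ i, Fin (m i) → X i → ℝ)
    (x : ∀ i, X i) : ((i : Fin N) × Fin (m i)) → ℝ :=
  fun p => g p.1 p.2 (x p.1)

/-- The vector `ḡ ∈ ℝ^m` with entries `∫ g_{i,j} dμ_i`. -/
def gbar {N : ℕ} {X : Fin N → Type*} [∀ i, MeasurableSpace (X i)] (m : Fin N → ℕ)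
    (g : ∀ i, Fin (m i) → X i → ℝ) (μ : ∀ i, Measure (X i)) :
    ((i : Fin N) × Fin (m i)) → ℝ :=
  fun p => ∫ t, g p.1 p.2 t ∂(μ p.1)

/-- `(y₀, y)` is feasible for the dual LSIP problem:
`y₀ + ⟨g(x), y⟩ ≤ f(x)` for all `x ∈ X`. -/
def DualFeasible {N : ℕ} {X : Fin N → Type*} (m : Fin N → ℕ)
    (g : ∀ i, Fin (m i) → X i → ℝ) (f : (∀ i, X i) → ℝ)
    (y₀ : ℝ) (y : ((i : Fin N) × Fin (m i)) → ℝ) : Prop :=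
  ∀ x : ∀ i, X i, y₀ + ∑ p, gvec m g x p * y p ≤ f x

/-- A convex cone together with the origin, as a pointed cone. -/
def ConvexCone.insertZero {E : Type*} [AddCommGroup E] [Module ℝ E] (C : ConvexCone ℝ E) :
    PointedCone ℝ E where
  carrier := {x | x = 0 ∨ x ∈ C}
  zero_mem' := Or.inl rfl
  add_mem' := by
    rintro a b (rfl | ha) (rfl | hb)
    · simp
    · simpa using Or.inr hb
    · simpa using Or.inr ha
    · exact Or.inr (C.add_mem ha hb)
  smul_mem' := by
    rintro ⟨c, hc⟩ x (rfl | hx)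
    · simp
    · rcases hc.eq_or_lt with rfl | hc
      · exact Or.inl (zero_smul ℝ x)
      · exact Or.inr (C.smul_mem hc hx)

/-- From a point of the relative interior one can move a little in every direction of the
affine span without leaving the set. -/
theorem exists_pos_add_smul_mem_of_mem_intrinsicInterior {E : Type*} [NormedAddCommGroup E]
    [NormedSpace ℝ E] {K : Set E} {a v : E} (ha : a ∈ intrinsicInterior ℝ K)
    (hv : v ∈ (affineSpan ℝ K).direction) : ∃ ε : ℝ, 0 < ε ∧ a + ε • v ∈ K := by
  obtain ⟨b, hb, rfl⟩ := mem_intrinsicInterior.1 ha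
  have hmem : ∀ ε : ℝ, (b : E) + ε • v ∈ affineSpan ℝ K := fun ε => by
    rw [add_comm]
    exact AffineSubspace.vadd_mem_of_mem_direction (Submodule.smul_mem _ ε hv) b.2
  have hcont : Continuous fun ε : ℝ => (⟨b + ε • v, hmem ε⟩ : affineSpan ℝ K) := by
    fun_prop
  have hnhds : ∀ᶠ ε : ℝ in nhds 0, (b : E) + ε • v ∈ K := by
    have h0 : (⟨b + (0 : ℝ) • v, hmem 0⟩ : affineSpan ℝ K) = b := by ext; simp
    have := hcont.tendsto 0
    rw [h0] at this
    exact this (mem_interior_iff_mem_nhds.1 hb)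
  obtain ⟨ε, hε, hε0⟩ :=
    ((hnhds.filter_mono nhdsWithin_le_nhds).and
      (self_mem_nhdsWithin : Set.Ioi (0 : ℝ) ∈ nhdsWithin 0 (Set.Ioi 0))).exists
  exact ⟨ε, hε0, hε⟩

/-- Existence of a subgradient of the lower envelope of a convex set `C ⊆ E × ℝ` at a point of
the relative interior of the projection of `C`. -/
theorem Convex.exists_subgradient_of_mem_intrinsicInterior {E : Type*} [NormedAddCommGroup E]
    [NormedSpace ℝ E] {C : Set (E × ℝ)} (hC : Convex ℝ C) {a : E} {p : ℝ}
    (ha : a ∈ intrinsicInterior ℝ (Prod.fst '' C)) (hp : ∀ t, (a, t) ∈ C → p ≤ t) :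
    ∃ l : E →ₗ[ℝ] ℝ, ∀ w ∈ C, p + l (w.1 - a) ≤ w.2 := by
  set V := (affineSpan ℝ (Prod.fst '' C)).direction
  obtain ⟨P, hP⟩ := V.subtype.exists_leftInverse_of_injective V.ker_subtype
  have hP' : ∀ v (hv : v ∈ V), P v = ⟨v, hv⟩ := fun v hv => LinearMap.congr_fun hP ⟨v, hv⟩
  let A : E × ℝ →ₗ[ℝ] E × ℝ := (V.subtype ∘ₗ P).prodMap LinearMap.id
  let D : Set (E × ℝ) := A ⁻¹' ((fun w => (a, p) + w) ⁻¹' C)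
  have hD : Convex ℝ D := (hC.translate_preimage_right (a, p)).linear_preimage A
  have hmemD {w : E × ℝ} : w ∈ ConvexCone.hull ℝ D ↔ ∃ c : ℝ, 0 < c ∧ c • w ∈ D := by
    rw [ConvexCone.mem_hull_of_convex hD]
    constructor
    · rintro ⟨r, hr, hw⟩
      exact ⟨r⁻¹, inv_pos.2 hr, (Set.mem_smul_set_iff_inv_smul_mem₀ hr.ne' _ _).1 hw⟩
    · rintro ⟨c, hc, hw⟩
      refine ⟨c⁻¹, inv_pos.2 hc, (Set.mem_smul_set_iff_inv_smul_mem₀ (inv_pos.2 hc).ne' _ _).2 ?_⟩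
      rwa [inv_inv]
  let φ : E × ℝ →ₗ.[ℝ] ℝ :=
    ⟨Submodule.prod ⊥ ⊤, LinearMap.snd ℝ E ℝ ∘ₗ (Submodule.prod ⊥ ⊤).subtype⟩
  have nonneg (w : φ.domain) (hw : (w : E × ℝ) ∈ (ConvexCone.hull ℝ D).insertZero) : 0 ≤ φ w := by
    obtain ⟨⟨v, t⟩, hvt⟩ := w
    obtain rfl : v = 0 := by simpa [φ] using hvt
    change 0 ≤ t
    rcases hw with h | h
    · exact (congrArg Prod.snd h).ge
    · obtain ⟨c, hc, h⟩ := hmemD.1 h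
      have := hp (p + c * t) (by simpa [D, A] using h)
      exact nonneg_of_mul_nonneg_right (by linarith) hc
  have dense (w : E × ℝ) :
      ∃ x : φ.domain, (x : E × ℝ) + w ∈ (ConvexCone.hull ℝ D).insertZero := by
    obtain ⟨v, t⟩ := w
    obtain ⟨ε, hε, ⟨u, r⟩, hr, hu⟩ :=
      exists_pos_add_smul_mem_of_mem_intrinsicInterior ha (P v).2
    obtain rfl : u = a + ε • (P v : E) := hu
    refine ⟨⟨(0, (r - p) / ε - t), by simp [φ]⟩, Or.inr (hmemD.2 ⟨ε, hε, ?_⟩)⟩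
    have : ε * ((r - p) / ε) = r - p := by field_simp
    simpa [D, A, this] using hr
  obtain ⟨G, hGφ, hG⟩ := riesz_extension _ φ nonneg dense
  refine ⟨-(G ∘ₗ LinearMap.inl ℝ E ℝ), fun w hw => ?_⟩
  have hwV : w.1 - a ∈ V :=
    AffineSubspace.vsub_mem_direction (subset_affineSpan ℝ _ ⟨w, hw, rfl⟩)
      (subset_affineSpan ℝ _ (intrinsicInterior_subset ha))
  have h1 : 0 ≤ G (w.1 - a, w.2 - p) := by
    refine hG _ (Or.inr (hmemD.2 ⟨1, one_pos, ?_⟩))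
    simpa [D, A, hP' _ hwV] using hw
  have h2 : G (0, w.2 - p) = w.2 - p := hGφ ⟨(0, w.2 - p), by simp [φ]⟩
  have h3 : G (w.1 - a, w.2 - p) = G (w.1 - a, 0) + G (0, w.2 - p) := by
    rw [← map_add]; simp
  simp only [LinearMap.neg_apply, LinearMap.comp_apply, LinearMap.inl_apply]
  linarith

section FiniteSupport

variable {A ι : Type*} [MeasurableSpace A] [Fintype ι] {w : ι → ℝ}

/-- The finitely supported measure with weights `w` at the points `x`. -/
def weightedDirac (w : ι → ℝ) (x : ι → A) : Measure A :=
  ∑ k, ENNReal.ofReal (w k) • Measure.dirac (x k)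

theorem isProbabilityMeasure_weightedDirac (x : ι → A) (hw : ∀ k, 0 ≤ w k)
    (hw1 : ∑ k, w k = 1) : IsProbabilityMeasure (weightedDirac w x) := by
  refine ⟨?_⟩
  simp [weightedDirac, ← ENNReal.ofReal_sum_of_nonneg fun k _ => hw k, hw1]

theorem integrable_weightedDirac [MeasurableSingletonClass A] (x : ι → A) (h : A → ℝ) :
    Integrable h (weightedDirac w x) :=
  integrable_finsetSum_measure.2 fun _ _ =>
    (integrable_dirac (by simp)).smul_measure ENNReal.ofReal_ne_top

theorem integral_weightedDirac [MeasurableSingletonClass A] (x : ι → A) (hw : ∀ k, 0 ≤ w k)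
    (h : A → ℝ) : ∫ y, h y ∂(weightedDirac w x) = ∑ k, w k * h (x k) := by
  rw [weightedDirac, integral_finsetSum_measure fun _ _ =>
    (integrable_dirac (by simp)).smul_measure ENNReal.ofReal_ne_top]
  simp [integral_smul_measure, ENNReal.toReal_ofReal (hw _)]

end FiniteSupport

section Duality

variable {N : ℕ} {X : Fin N → Type*} [∀ i, MeasurableSpace (X i)] [∀ i, MetricSpace (X i)]
  {μ : ∀ i, Measure (X i)} {f : (∀ i, X i) → ℝ} {m : Fin N → ℕ} {g : ∀ i, Fin (m i) → X i → ℝ}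

/-- Weak duality. -/
theorem DualFeasible.value_le_of_mem_OTValues {z₀ r : ℝ} {z : ((i : Fin N) × Fin (m i)) → ℝ}
    (hz : DualFeasible m g f z₀ z)
    (hr : r ∈ OTValues f {γ | IsRelaxedCoupling γ μ fun i => Set.range (g i)}) :
    z₀ + ∑ p, gbar m g μ p * z p ≤ r := by
  obtain ⟨γ, ⟨hγ, hmarg⟩, hintg, rfl⟩ := hr
  have hg (p : (i : Fin N) × Fin (m i)) : Integrable (fun x => gvec m g x p) γ ∧
      ∫ x, gvec m g x p ∂γ = gbar m g μ p := by
    obtain ⟨h1, h2⟩ := (hmarg p.1).2.2 _ ⟨p.2, rfl⟩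
    have hm := measurable_pi_apply (X := X) p.1
    exact ⟨h1.comp_measurable hm,
      (integral_map hm.aemeasurable h1.aestronglyMeasurable).symm.trans h2⟩
  have hsum : Integrable (fun x => ∑ p, gvec m g x p * z p) γ :=
    integrable_finsetSum _ fun p _ => (hg p).1.mul_const _
  calc z₀ + ∑ p, gbar m g μ p * z p
      = ∫ x, (z₀ + ∑ p, gvec m g x p * z p) ∂γ := by
        rw [integral_add (integrable_const _) hsum,
          integral_finsetSum _ fun p _ => (hg p).1.mul_const _]
        simp [integral_mul_const, (hg _).2]
    _ ≤ ∫ x, f x ∂γ := integral_mono ((integrable_const _).add hsum) hintg hz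

/-- Convex combinations of the points `(g x, f x)` lying above `ḡ` are values of the primal
problem. -/
theorem mem_OTValues_of_mem_convexHull [∀ i, PolishSpace (X i)] [∀ i, BorelSpace (X i)]
    (hX : ∀ i, Nonempty (X i)) (hg_meas : ∀ i j, Measurable (g i j)) {t : ℝ}
    (ht : (gbar m g μ, t) ∈ convexHull ℝ (Set.range fun x => (gvec m g x, f x))) :
    t ∈ OTValues f {γ | IsRelaxedCoupling γ μ fun i => Set.range (g i)} := by
  obtain ⟨ι, _, w, z, hw, hw1, hz, hsum⟩ := mem_convexHull_iff_exists_fintype.1 ht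
  choose x hx using hz
  have h1 (p : (i : Fin N) × Fin (m i)) : ∑ k, w k * gvec m g (x k) p = gbar m g μ p := by
    simpa [Prod.fst_sum, ← hx] using congrFun (congrArg Prod.fst hsum) p
  have h2 : ∑ k, w k * f (x k) = t := by
    simpa [Prod.snd_sum, ← hx] using congrArg Prod.snd hsum
  have hprob := isProbabilityMeasure_weightedDirac x hw hw1
  refine ⟨weightedDirac w x, ⟨hprob, fun i => ?_⟩, integrable_weightedDirac x f,
    (integral_weightedDirac x hw f).trans h2⟩
  have hm := measurable_pi_apply (X := X) i
  have hintg {h : X i → ℝ} (hh : Measurable h) :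
      Integrable h ((weightedDirac w x).map fun x => x i) :=
    (integrable_map_measure hh.aestronglyMeasurable hm.aemeasurable).2
      (integrable_weightedDirac x _)
  refine ⟨Measure.isProbabilityMeasure_map hm.aemeasurable,
    ⟨(hX i).some, hintg (continuous_const.dist continuous_id).measurable⟩, ?_⟩
  rintro _ ⟨j, rfl⟩
  refine ⟨hintg (hg_meas i j), ?_⟩
  rw [integral_map hm.aemeasurable (hg_meas i j).aestronglyMeasurable,
    integral_weightedDirac x hw]
  exact h1 ⟨i, j⟩

end Duality

/-- **Theorem 2.12 (ii)+(iii) under (SD1)**: if the dual LSIP problem is feasible and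
`ḡ` lies in the relative interior of `K = conv({g(x) : x ∈ X})`, then strong duality
holds and the dual supremum is attained: there is a feasible `(y₀*, y*)` dominating all
feasible points whose value equals the primal infimum. -/
theorem lsip_strong_duality_relint {N : ℕ} {X : Fin N → Type*}
    [∀ i, MeasurableSpace (X i)] [∀ i, MetricSpace (X i)]
    [∀ i, PolishSpace (X i)] [∀ i, BorelSpace (X i)]
    (μ : ∀ i, Measure (X i)) (hμprob : ∀ i, IsProbabilityMeasure (μ i))
    (hμP1 : ∀ i, HasFiniteFirstMoment (μ i))
    (f : (∀ i, X i) → ℝ)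
    (hf_lsc : LowerSemicontinuous f)
    (hf_lb : ∃ h : ∀ i, X i → ℝ, (∀ i, UpperSemicontinuous (h i)) ∧
      (∀ i, Integrable (h i) (μ i)) ∧ ∀ x : ∀ i, X i, (∑ i, h i (x i)) ≤ f x)
    (m : Fin N → ℕ) (g : ∀ i, Fin (m i) → X i → ℝ)
    (hg_meas : ∀ i j, Measurable (g i j))
    (hg_int : ∀ i j, Integrable (g i j) (μ i))
    (hfeas : ∃ (y₀ : ℝ) (y : ((i : Fin N) × Fin (m i)) → ℝ), DualFeasible m g f y₀ y)
    (hrelint : gbar m g μ ∈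
      intrinsicInterior ℝ (convexHull ℝ (Set.range (gvec m g)))) :
    ∃ (y₀ : ℝ) (y : ((i : Fin N) × Fin (m i)) → ℝ),
      DualFeasible m g f y₀ y ∧
      (∀ (z₀ : ℝ) (z : ((i : Fin N) × Fin (m i)) → ℝ), DualFeasible m g f z₀ z →
        z₀ + ∑ p, gbar m g μ p * z p ≤ y₀ + ∑ p, gbar m g μ p * y p) ∧
      y₀ + ∑ p, gbar m g μ p * y p =
        sInf (OTValues f
          {γ : Measure (∀ i, X i) | IsRelaxedCoupling γ μ (fun i => Set.range (g i))}) := by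
  have hX (i) : Nonempty (X i) := (hμP1 i).nonempty
  set C := convexHull ℝ (Set.range fun x => (gvec m g x, f x))
  set S := OTValues f {γ | IsRelaxedCoupling γ μ fun i => Set.range (g i)}
  obtain ⟨z₀, z, hz⟩ := hfeas
  have hbdd : BddBelow S := ⟨_, fun r hr => hz.value_le_of_mem_OTValues hr⟩
  have hCS (t : ℝ) (ht : (gbar m g μ, t) ∈ C) : t ∈ S :=
    mem_OTValues_of_mem_convexHull hX hg_meas ht
  have hproj : Prod.fst '' C = convexHull ℝ (Set.range (gvec m g)) := by
    have := (LinearMap.fst ℝ (((i : Fin N) × Fin (m i)) → ℝ) ℝ).image_convexHull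
      (Set.range fun x => (gvec m g x, f x))
    rw [← Set.range_comp] at this
    exact this
  rw [← hproj] at hrelint
  have hne : S.Nonempty := by
    obtain ⟨⟨v, t⟩, hvt, hv⟩ := intrinsicInterior_subset hrelint
    obtain rfl : v = gbar m g μ := hv
    exact ⟨t, hCS t hvt⟩
  obtain ⟨l, hl⟩ := (convex_convexHull ℝ _).exists_subgradient_of_mem_intrinsicInterior hrelint
    fun t ht => csInf_le hbdd (hCS t ht)
  have hl_sum (v : ((i : Fin N) × Fin (m i)) → ℝ) : ∑ p, v p * l (Pi.single p 1) = l v := by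
    rw [LinearMap.pi_apply_eq_sum_univ l v]
    refine Finset.sum_congr rfl fun p _ => ?_
    rw [smul_eq_mul]
    congr 3
    ext q
    simp [Pi.single_apply, eq_comm]
  have hval : sInf S - l (gbar m g μ) + ∑ p, gbar m g μ p * l (Pi.single p 1) = sInf S := by
    rw [hl_sum]; ring
  refine ⟨sInf S - l (gbar m g μ), fun p => l (Pi.single p 1), fun x => ?_,
    fun y₀ y hy => ?_, hval⟩
  · have := hl _ (subset_convexHull ℝ _ ⟨x, rfl⟩)
    rw [map_sub] at this
    rw [hl_sum]
    linarith
  · rw [hval]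
    exact le_csInf hne fun r hr => hy.value_le_of_mem_OTValues hr

end
end

section
/- Let the cost Assumption hold and let G_i = {g_{i,1},...,g_{i,m_i}} be finite sets of μ_i-integrable Borel functions, with m := Σ_i m_i and g, ḡ, K as in the LSIP setup. Suppose there exists at least one (y_0,y) ∈ ℝ×ℝ^m with y_0 + ⟨g(x),y⟩ ≤ f(x) for all x ∈ X, and suppose ḡ lies in the (topological) interior of K := conv({g(x) : x ∈ X}) ⊆ ℝ^m. Then the set of optimizers of the dual LSIP problem, i.e. the set of feasible (y_0,y) attaining sup{ y_0' + ⟨ḡ,y'⟩ : y_0' + ⟨g(x),y'⟩ ≤ f(x) ∀x ∈ X }, is a bounded subset of ℝ^{m+1}. -/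
open MeasureTheory

noncomputable section

/-- Over a fixed point of the convex hull of the range of the test functions, the dual
objective is bounded above uniformly over all dual feasible pairs. -/
theorem exists_forall_dualFeasible_le_of_mem_convexHull {N : ℕ} {X : Fin N → Type*}
    (m : Fin N → ℕ) (g : ∀ i, Fin (m i) → X i → ℝ) (f : (∀ i, X i) → ℝ)
    {a : ((i : Fin N) × Fin (m i)) → ℝ}
    (ha : a ∈ convexHull ℝ (Set.range (gvec m g))) :
    ∃ C : ℝ, ∀ y₀ y, DualFeasible m g f y₀ y → y₀ + ∑ p, a p * y p ≤ C := by
  refine convexHull_min (t := {a | ∃ C : ℝ, ∀ y₀ y, DualFeasible m g f y₀ y →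
    y₀ + ∑ p, a p * y p ≤ C}) ?_ ?_ ha
  · rintro _ ⟨x, rfl⟩
    exact ⟨f x, fun y₀ y h => h x⟩
  · rintro a ⟨C, hC⟩ b ⟨D, hD⟩ s t hs ht hst
    refine ⟨s * C + t * D, fun y₀ y h => ?_⟩
    have hsum : ∑ p, (s • a + t • b) p * y p = s * ∑ p, a p * y p + t * ∑ p, b p * y p := by
      simp only [Finset.mul_sum, ← Finset.sum_add_distrib]
      refine Finset.sum_congr rfl fun p _ => ?_
      simp only [Pi.add_apply, Pi.smul_apply, smul_eq_mul]
      ring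
    rw [hsum]
    calc y₀ + (s * ∑ p, a p * y p + t * ∑ p, b p * y p)
        = s * (y₀ + ∑ p, a p * y p) + t * (y₀ + ∑ p, b p * y p) := by
          linear_combination (-y₀) * hst
      _ ≤ s * C + t * D := by
          gcongr
          · exact hC y₀ y h
          · exact hD y₀ y h

/-- **Theorem 2.12 (iv) under (SD1')**: if the dual LSIP problem is feasible and `ḡ` lies
in the topological interior of `K = conv({g(x) : x ∈ X})`, then the set of optimizers of
the dual LSIP problem is a bounded subset of `ℝ^{m+1}`. -/
theorem lsip_bounded_optimizers {N : ℕ} {X : Fin N → Type*}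
    [∀ i, MeasurableSpace (X i)] [∀ i, MetricSpace (X i)]
    [∀ i, PolishSpace (X i)] [∀ i, BorelSpace (X i)]
    (μ : ∀ i, Measure (X i)) (hμprob : ∀ i, IsProbabilityMeasure (μ i))
    (hμP1 : ∀ i, HasFiniteFirstMoment (μ i))
    (f : (∀ i, X i) → ℝ)
    (hf_lsc : LowerSemicontinuous f)
    (hf_lb : ∃ h : ∀ i, X i → ℝ, (∀ i, UpperSemicontinuous (h i)) ∧
      (∀ i, Integrable (h i) (μ i)) ∧ ∀ x : ∀ i, X i, (∑ i, h i (x i)) ≤ f x)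
    (m : Fin N → ℕ) (g : ∀ i, Fin (m i) → X i → ℝ)
    (hg_meas : ∀ i j, Measurable (g i j))
    (hg_int : ∀ i j, Integrable (g i j) (μ i))
    (hfeas : ∃ (y₀ : ℝ) (y : ((i : Fin N) × Fin (m i)) → ℝ), DualFeasible m g f y₀ y)
    (hint : gbar m g μ ∈
      interior (convexHull ℝ (Set.range (gvec m g)))) :
    Bornology.IsBounded
      {q : ℝ × (((i : Fin N) × Fin (m i)) → ℝ) |
        DualFeasible m g f q.1 q.2 ∧
        ∀ (z₀ : ℝ) (z : ((i : Fin N) × Fin (m i)) → ℝ), DualFeasible m g f z₀ z →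
          z₀ + ∑ p, gbar m g μ p * z p ≤ q.1 + ∑ p, gbar m g μ p * q.2 p} := by
  obtain ⟨v₀, v, hv⟩ := hfeas
  obtain ⟨ε, hε, hball⟩ := Metric.mem_nhds_iff.1 (mem_interior_iff_mem_nhds.1 hint)
  set a := gbar m g μ
  have hshift (p) (t : ℝ) (ht : |t| < ε) : ∃ C : ℝ, ∀ y₀ y, DualFeasible m g f y₀ y →
      y₀ + ∑ r, a r * y r + t * y p ≤ C := by
    have hmem : a + Pi.single p t ∈ convexHull ℝ (Set.range (gvec m g)) := by
      apply hball
      simpa [Metric.mem_ball, dist_eq_norm, Pi.norm_single] using ht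
    obtain ⟨C, hC⟩ := exists_forall_dualFeasible_le_of_mem_convexHull m g f hmem
    refine ⟨C, fun y₀ y h => ?_⟩
    have := hC y₀ y h
    simpa [add_mul, Finset.sum_add_distrib, Pi.single_apply, ← add_assoc] using this
  have habs : |ε / 2| < ε := by rw [abs_of_pos (by positivity)]; linarith
  choose C hC using fun p => hshift p (ε / 2) habs
  choose D hD using fun p => hshift p (-(ε / 2)) (by rwa [abs_neg])
  obtain ⟨E, hE⟩ := exists_forall_dualFeasible_le_of_mem_convexHull m g f (interior_subset hint)
  set V := v₀ + ∑ p, a p * v p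
  set B : ((i : Fin N) × Fin (m i)) → ℝ := fun p => max (C p - V) (D p - V) / (ε / 2) with hB
  refine (isCompact_Icc (a := (V - ∑ p, |a p| * B p, -B))
    (b := (E + ∑ p, |a p| * B p, B))).isBounded.subset ?_
  rintro ⟨q₀, q⟩ ⟨hq, hopt⟩
  have hV : V ≤ q₀ + ∑ p, a p * q p := hopt v₀ v hv
  have hqB (p) : |q p| ≤ B p := by
    rw [hB, le_div_iff₀ (by positivity), ← abs_of_pos (half_pos hε), ← abs_mul]
    refine abs_le'.2 ⟨le_max_of_le_left ?_, le_max_of_le_right ?_⟩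
    · linarith [hC p q₀ q hq]
    · linarith [hD p q₀ q hq]
  have hS : |∑ p, a p * q p| ≤ ∑ p, |a p| * B p := by
    refine (Finset.abs_sum_le_sum_abs _ _).trans (Finset.sum_le_sum fun p _ => ?_)
    rw [abs_mul]
    gcongr
    exact hqB p
  have hq₀ : q₀ + ∑ p, a p * q p ≤ E := hE q₀ q hq
  obtain ⟨hS₁, hS₂⟩ := abs_le.1 hS
  refine ⟨⟨?_, fun p => (abs_le.1 (hqB p)).1⟩, ⟨?_, fun p => (abs_le.1 (hqB p)).2⟩⟩
  · change V - ∑ p, |a p| * B p ≤ q₀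
    linarith
  · change q₀ ≤ E + ∑ p, |a p| * B p
    linarith

end
end

section
/- Let the cost Assumption hold and let G_i = {g_{i,1},...,g_{i,m_i}} be finite sets of μ_i-integrable Borel functions, with m := Σ_i m_i and g, ḡ, K as in the LSIP setup. Suppose that for each i = 1,...,N the support of μ_i is all of X_i and the functions g_{i,1},...,g_{i,m_i} are continuous. Then ḡ belongs to the relative interior of K := conv({g(x) : x ∈ X}). -/
open MeasureTheory

noncomputable section

open Set in
/-- The mean of a continuous function whose values affinely span the space lies in the interior of
the convex hull of its range, provided the measure charges all nonempty open sets. -/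
theorem integral_mem_interior_convexHull_range {Y E : Type*} [TopologicalSpace Y]
    [MeasurableSpace Y] [NormedAddCommGroup E] [NormedSpace ℝ E] [FiniteDimensional ℝ E]
    (P : Measure Y) [IsProbabilityMeasure P] [P.IsOpenPosMeasure] {F : Y → E}
    (hF : Continuous F) (hint : Integrable F P) (hspan : affineSpan ℝ (range F) = ⊤) :
    ∫ y, F y ∂P ∈ interior (convexHull ℝ (range F)) := by
  by_contra hx
  have hne : (interior (convexHull ℝ (range F))).Nonempty :=
    interior_convexHull_nonempty_iff_affineSpan_eq_top.2 hspan
  have hconv : Convex ℝ (convexHull ℝ (range F)) := convex_convexHull ℝ _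
  obtain ⟨f, hf⟩ := geometric_hahn_banach_open_point hconv.interior isOpen_interior hx
  have hle : ∀ y, f (F y) ≤ f (∫ y, F y ∂P) := fun y => by
    have hy : F y ∈ closure (interior (convexHull ℝ (range F))) := by
      rw [hconv.closure_interior_eq_closure_of_nonempty_interior hne]
      exact subset_closure (subset_convexHull ℝ _ (mem_range_self y))
    exact closure_minimal (fun a ha => (hf a ha).le)
      (isClosed_le f.continuous continuous_const) hy
  have hfint : Integrable (fun y => f (F y)) P := f.integrable_comp hint
  have hzero : ∫ y, (f (∫ y, F y ∂P) - f (F y)) ∂P = 0 := by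
    rw [integral_sub (integrable_const _) hfint, f.integral_comp_comm hint]
    simp
  rw [integral_eq_zero_iff_of_nonneg (fun y => sub_nonneg.2 (hle y))
    ((integrable_const _).sub hfint)] at hzero
  have heq := (Continuous.ae_eq_iff_eq P (continuous_const.sub (f.continuous.comp hF))
    continuous_const).1 hzero
  have hsub : convexHull ℝ (range F) ⊆ {a | f a = f (∫ y, F y ∂P)} := by
    refine convexHull_min ?_ (convex_hyperplane f.toLinearMap.isLinear _)
    rintro _ ⟨y, rfl⟩
    exact (sub_eq_zero.1 (congrFun heq y)).symm
  obtain ⟨a, ha⟩ := hne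
  exact (hf a ha).ne (hsub (interior_subset ha))

open Set in
/-- The mean of a continuous function lies in the relative interior of the convex hull of its
range, provided the measure charges all nonempty open sets. -/
theorem integral_mem_intrinsicInterior_convexHull_range {Y V : Type*} [TopologicalSpace Y]
    [MeasurableSpace Y] [OpensMeasurableSpace Y] [NormedAddCommGroup V] [NormedSpace ℝ V]
    [FiniteDimensional ℝ V] (P : Measure Y) [IsProbabilityMeasure P] [P.IsOpenPosMeasure]
    {F : Y → V} (hF : Continuous F) (hint : Integrable F P) :
    ∫ y, F y ∂P ∈ intrinsicInterior ℝ (convexHull ℝ (range F)) := by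
  obtain ⟨y₀⟩ : Nonempty Y := P.nonempty_of_neZero
  let W := (affineSpan ℝ (range F)).direction
  have hmem (y : Y) : F y ∈ affineSpan ℝ (range F) := subset_affineSpan ℝ _ (mem_range_self y)
  let G : Y → W := fun y => ⟨F y - F y₀, AffineSubspace.vsub_mem_direction (hmem y) (hmem y₀)⟩
  let φ : W →ᵃⁱ[ℝ] V :=
    (AffineIsometryEquiv.vaddConst ℝ (F y₀)).toAffineIsometry.comp W.subtypeₗᵢ.toAffineIsometry
  have hφ (w : W) : φ w = w + F y₀ := rfl
  have hφG : φ ∘ G = F := funext fun y => by simp [hφ, G]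
  have hGc : Continuous G := (hF.sub continuous_const).subtype_mk _
  have hGint : Integrable G P :=
    (hint.sub (integrable_const (F y₀))).mono hGc.aestronglyMeasurable (ae_of_all _ fun _ => le_rfl)
  have hrange : φ '' range G = range F := by rw [← range_comp, hφG]
  have hspan : affineSpan ℝ (range G) = ⊤ := by
    refine eq_top_iff.2 fun w _ => ?_
    have hw : φ w ∈ (affineSpan ℝ (range G)).map φ.toAffineMap := by
      rw [AffineSubspace.map_span]
      change φ w ∈ affineSpan ℝ (φ '' range G)
      rw [hrange, hφ]
      exact AffineSubspace.vadd_mem_of_mem_direction w.2 (hmem y₀)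
    obtain ⟨v, hv, hvw⟩ := hw
    exact φ.injective hvw ▸ hv
  have hmean : φ (∫ y, G y ∂P) = ∫ y, F y ∂P := by
    have h := W.subtypeL.integral_comp_comm hGint
    rw [hφ]
    change _ = W.subtypeL (∫ y, G y ∂P) at h
    change W.subtypeL (∫ y, G y ∂P) + _ = _
    rw [← h]
    change ∫ y, (F y - F y₀) ∂P + _ = _
    rw [integral_sub hint (integrable_const _)]
    simp
  have hhull : φ '' convexHull ℝ (range G) = convexHull ℝ (range F) := by
    rw [← hrange]
    exact φ.toAffineMap.image_convexHull _
  rw [← hmean, ← hhull, φ.intrinsicInterior_image]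
  exact mem_image_of_mem _ (interior_subset_intrinsicInterior
    (integral_mem_interior_convexHull_range P hGc hGint hspan))

/-- **Proposition 2.14 (i)**: if for each `i` the support of `μ_i` is all of `X_i` (every
nonempty open set has positive measure) and all test functions are continuous, then `ḡ`
lies in the relative interior of `K = conv({g(x) : x ∈ X})`. -/
theorem gbar_mem_relint {N : ℕ} {X : Fin N → Type*}
    [∀ i, MeasurableSpace (X i)] [∀ i, MetricSpace (X i)]
    [∀ i, PolishSpace (X i)] [∀ i, BorelSpace (X i)]
    (μ : ∀ i, Measure (X i)) (hμprob : ∀ i, IsProbabilityMeasure (μ i))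
    (hμP1 : ∀ i, HasFiniteFirstMoment (μ i))
    (f : (∀ i, X i) → ℝ)
    (hf_lsc : LowerSemicontinuous f)
    (hf_lb : ∃ h : ∀ i, X i → ℝ, (∀ i, UpperSemicontinuous (h i)) ∧
      (∀ i, Integrable (h i) (μ i)) ∧ ∀ x : ∀ i, X i, (∑ i, h i (x i)) ≤ f x)
    (m : Fin N → ℕ) (g : ∀ i, Fin (m i) → X i → ℝ)
    (hg_meas : ∀ i j, Measurable (g i j))
    (hg_int : ∀ i j, Integrable (g i j) (μ i))
    (hsupp : ∀ i, ∀ U : Set (X i), IsOpen U → U.Nonempty → μ i U ≠ 0)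
    (hg_cont : ∀ i j, Continuous (g i j)) :
    gbar m g μ ∈ intrinsicInterior ℝ (convexHull ℝ (Set.range (gvec m g))) := by
  have hpos (i : Fin N) : (μ i).IsOpenPosMeasure := ⟨hsupp i⟩
  have hcont : Continuous (gvec m g) :=
    continuous_pi fun p => (hg_cont p.1 p.2).comp (continuous_apply p.1)
  have hint (p : (i : Fin N) × Fin (m i)) :
      Integrable (fun x => gvec m g x p) (Measure.pi μ) :=
    integrable_comp_eval (hg_int p.1 p.2)
  have hmean : ∫ x, gvec m g x ∂(Measure.pi μ) = gbar m g μ := by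
    funext p
    rw [eval_integral hint]
    exact integral_comp_eval (hg_int p.1 p.2).aestronglyMeasurable
  rw [← hmean]
  exact integral_mem_intrinsicInterior_convexHull_range _ hcont (Integrable.of_eval hint)

end
end

section
/- Let the cost Assumption hold and let G_i = {g_{i,1},...,g_{i,m_i}} be finite sets of μ_i-integrable Borel functions, with m := Σ_i m_i and g, ḡ, K as in the LSIP setup. Suppose that for each i = 1,...,N the support of μ_i is all of X_i, the functions g_{i,1},...,g_{i,m_i} are continuous, and, writing g_i(x) := (g_{i,1}(x),...,g_{i,m_i}(x))^T ∈ ℝ^{m_i}, there exist m_i + 1 points x_{i,1},...,x_{i,m_i+1} ∈ X_i such that the vectors g_i(x_{i,1}),...,g_i(x_{i,m_i+1}) ∈ ℝ^{m_i} are affinely independent. Then ḡ belongs to the (topological) interior of K := conv({g(x) : x ∈ X}). -/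
open MeasureTheory

noncomputable section

/-- A point outside the interior of a convex hull is exposed by a nonzero linear functional, unless
the set lies in a hyperplane. -/
lemma exists_linearMap_of_notMem_interior_convexHull {V : Type*} [NormedAddCommGroup V]
    [NormedSpace ℝ V] [FiniteDimensional ℝ V] {s : Set V} (hs : s.Nonempty) {p : V}
    (hp : p ∉ interior (convexHull ℝ s)) :
    ∃ L : V →ₗ[ℝ] ℝ, L ≠ 0 ∧ ((∀ a ∈ s, L a ≤ L p) ∨ ∀ a ∈ s, ∀ b ∈ s, L a = L b) := by
  by_cases hne : (interior (convexHull ℝ s)).Nonempty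
  · obtain ⟨L, hL, hle⟩ :=
      geometric_hahn_banach_of_nonempty_interior_point (convex_convexHull ℝ s) hp hne
    refine ⟨L, fun h => hL ?_, Or.inl fun a ha => hle a (subset_convexHull ℝ s ha)⟩
    ext v
    exact LinearMap.congr_fun h v
  · rw [interior_convexHull_nonempty_iff_affineSpan_eq_top,
      AffineSubspace.affineSpan_eq_top_iff_vectorSpan_eq_top_of_nonempty ℝ V V hs] at hne
    obtain ⟨L, hL, hker⟩ := Submodule.exists_le_ker_of_lt_top _ (lt_top_iff_ne_top.2 hne)
    refine ⟨L, hL, Or.inr fun a ha b hb => ?_⟩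
    have h : L (a -ᵥ b) = 0 := hker (vsub_mem_vectorSpan ℝ ha hb)
    rw [vsub_eq_sub, map_sub] at h
    linarith

/-- A linear functional which is constant on an affine frame vanishes. -/
lemma AffineIndependent.linearMap_eq_zero {k V ι : Type*} [Field k] [AddCommGroup V] [Module k V]
    [FiniteDimensional k V] [Fintype ι] {p : ι → V} (hp : AffineIndependent k p)
    (hcard : Fintype.card ι = Module.finrank k V + 1) {L : V →ₗ[k] k}
    (hL : ∀ a b, L (p a) = L (p b)) : L = 0 := by
  have hspan : vectorSpan k (Set.range p) ≤ LinearMap.ker L := by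
    rw [vectorSpan, Submodule.span_le]
    rintro _ ⟨_, ⟨a, rfl⟩, _, ⟨b, rfl⟩, rfl⟩
    simp [hL a b]
  rw [hp.vectorSpan_eq_top_of_card_eq_finrank_add_one hcard, top_le_iff] at hspan
  exact LinearMap.ker_eq_top.1 hspan

/-- A continuous function bounded above by its mean is constant if the measure has full support. -/
lemma Continuous.eq_integral_of_le_integral {Y : Type*} [TopologicalSpace Y] [MeasurableSpace Y]
    {μ : Measure Y} [IsProbabilityMeasure μ] [μ.IsOpenPosMeasure] {φ : Y → ℝ}
    (hφ : Continuous φ) (hint : Integrable φ μ) (hle : ∀ t, φ t ≤ ∫ y, φ y ∂μ) (t : Y) :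
    φ t = ∫ y, φ y ∂μ := by
  have hae : φ =ᵐ[μ] fun _ => ∫ y, φ y ∂μ :=
    (integral_eq_iff_of_ae_le hint (integrable_const _) (ae_of_all _ hle)).1 (by simp)
  exact congrFun ((hφ.ae_eq_iff_eq μ continuous_const).1 hae) t

/-- If a sum of functions of separate variables is bounded by the sum of the means, then each
summand is bounded by its own mean. -/
lemma le_integral_of_sum_le_sum_integral {ι : Type*} [Fintype ι] [DecidableEq ι] {X : ι → Type*}
    [∀ i, MeasurableSpace (X i)] {μ : ∀ i, Measure (X i)} [∀ i, IsProbabilityMeasure (μ i)]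
    {φ : ∀ i, X i → ℝ} (hint : ∀ i, Integrable (φ i) (μ i))
    (hle : ∀ x : ∀ i, X i, ∑ i, φ i (x i) ≤ ∑ i, ∫ y, φ i y ∂μ i) (i : ι) (t : X i) :
    φ i t ≤ ∫ y, φ i y ∂μ i := by
  choose z hz using fun j => exists_integral_le (hint j)
  have hsum := hle (Function.update z i t)
  rw [← Finset.add_sum_erase _ _ (Finset.mem_univ i),
    ← Finset.add_sum_erase _ (fun j => ∫ y, φ j y ∂μ j) (Finset.mem_univ i)] at hsum
  have hrest : ∑ j ∈ Finset.univ.erase i, ∫ y, φ j y ∂μ j ≤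
      ∑ j ∈ Finset.univ.erase i, φ j (Function.update z i t j) := by
    refine Finset.sum_le_sum fun j hj => ?_
    rw [Function.update_of_ne (Finset.ne_of_mem_erase hj)]
    exact hz j
  rw [Function.update_self] at hsum
  linarith

/-- **Proposition 2.14 (ii)**: if in addition to the assumptions of part (i), for each `i`
there exist `m_i + 1` points of `X_i` whose images under `g_i = (g_{i,1}, …, g_{i,m_i})`
are affinely independent in `ℝ^{m_i}`, then `ḡ` lies in the topological interior of
`K = conv({g(x) : x ∈ X})`. -/
theorem gbar_mem_interior {N : ℕ} {X : Fin N → Type*}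
    [∀ i, MeasurableSpace (X i)] [∀ i, MetricSpace (X i)]
    [∀ i, PolishSpace (X i)] [∀ i, BorelSpace (X i)]
    (μ : ∀ i, Measure (X i)) (hμprob : ∀ i, IsProbabilityMeasure (μ i))
    (hμP1 : ∀ i, HasFiniteFirstMoment (μ i))
    (f : (∀ i, X i) → ℝ)
    (hf_lsc : LowerSemicontinuous f)
    (hf_lb : ∃ h : ∀ i, X i → ℝ, (∀ i, UpperSemicontinuous (h i)) ∧
      (∀ i, Integrable (h i) (μ i)) ∧ ∀ x : ∀ i, X i, (∑ i, h i (x i)) ≤ f x)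
    (m : Fin N → ℕ) (g : ∀ i, Fin (m i) → X i → ℝ)
    (hg_meas : ∀ i j, Measurable (g i j))
    (hg_int : ∀ i j, Integrable (g i j) (μ i))
    (hsupp : ∀ i, ∀ U : Set (X i), IsOpen U → U.Nonempty → μ i U ≠ 0)
    (hg_cont : ∀ i j, Continuous (g i j))
    (haff : ∀ i, ∃ x : Fin (m i + 1) → X i,
      AffineIndependent ℝ (fun k => (fun j => g i j (x k) : Fin (m i) → ℝ))) :
    gbar m g μ ∈ interior (convexHull ℝ (Set.range (gvec m g))) := by
  by_contra hmem
  classical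
  have hpos : ∀ i, (μ i).IsOpenPosMeasure := fun i => ⟨hsupp i⟩
  have hne : ∀ i, Nonempty (X i) := fun i => nonempty_of_isProbabilityMeasure (μ i)
  obtain ⟨L, hL, hcases⟩ := exists_linearMap_of_notMem_interior_convexHull
    (Set.range_nonempty (gvec m g)) hmem
  set y : ((i : Fin N) × Fin (m i)) → ℝ := fun p => L fun q => if p = q then 1 else 0 with hy
  have hLsum : ∀ v, L v = ∑ i, ∑ j, v ⟨i, j⟩ * y ⟨i, j⟩ := fun v => by
    rw [L.pi_apply_eq_sum_univ v, Fintype.sum_sigma]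
    simp only [smul_eq_mul, hy]
  set φ : ∀ i, X i → ℝ := fun i t => ∑ j, g i j t * y ⟨i, j⟩ with hφ
  have hφint : ∀ i, Integrable (φ i) (μ i) := fun i =>
    integrable_finsetSum _ fun j _ => (hg_int i j).mul_const _
  have hφcont : ∀ i, Continuous (φ i) := fun i =>
    continuous_finsetSum _ fun j _ => (hg_cont i j).mul continuous_const
  have hLgvec : ∀ x, L (gvec m g x) = ∑ i, φ i (x i) := fun x => hLsum _
  have hLgbar : L (gbar m g μ) = ∑ i, ∫ t, φ i t ∂μ i := by
    rw [hLsum]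
    refine Finset.sum_congr rfl fun i _ => ?_
    rw [integral_finsetSum _ fun j _ => (hg_int i j).mul_const _]
    simp [gbar, integral_mul_const]
  have hle : ∀ x : ∀ i, X i, ∑ i, φ i (x i) ≤ ∑ i, ∫ t, φ i t ∂μ i := fun x => by
    rcases hcases with h | h
    · simpa only [hLgvec, hLgbar] using h _ ⟨x, rfl⟩
    · choose z hz using fun i => exists_le_integral (hφint i)
      have hxz := h _ ⟨x, rfl⟩ _ ⟨z, rfl⟩
      rw [hLgvec, hLgvec] at hxz
      rw [hxz]
      exact Finset.sum_le_sum fun i _ => hz i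
  have hconst : ∀ i t, φ i t = ∫ s, φ i s ∂μ i := fun i =>
    (hφcont i).eq_integral_of_le_integral (hφint i)
      (le_integral_of_sum_le_sum_integral hφint hle i)
  have hy0 : ∀ i j, y ⟨i, j⟩ = 0 := fun i j => by
    obtain ⟨x, hx⟩ := haff i
    have hzero := hx.linearMap_eq_zero (by simp)
      (L := Fintype.linearCombination ℝ fun j => y ⟨i, j⟩) fun a b => by
        simpa [Fintype.linearCombination_apply, hφ] using
          (hconst i (x a)).trans (hconst i (x b)).symm
    simpa using LinearMap.congr_fun hzero (Pi.single j 1)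
  exact hL (LinearMap.ext fun v => by simp [hLsum, hy0])

end
end

section
/- Suppose that for each i = 1,...,N, (X_i†, d_i†) is a Polish space with X_i ⊆ X_i† and d_i equal to the restriction of d_i† to X_i, and let X† := X_1†×···×X_N† carry the 1-product metric. For each i, define μ_i† ∈ P_1(X_i†) by μ_i†(E) := μ_i(E ∩ X_i) for Borel E ⊆ X_i†, and similarly for any μ ∈ P_1(X) define μ† ∈ P_1(X†) by μ†(E) := μ(E ∩ X) for Borel E ⊆ X†. Then for any μ̂, μ̃ ∈ P_1(X): μ̃ ∈ R(μ̂; μ_1,...,μ_N) if and only if μ̃† ∈ R(μ̂†; μ_1†,...,μ_N†). -/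
open MeasureTheory

noncomputable section

section Embedding

variable {A B : Type*} [MeasurableSpace A] [MeasurableSpace B]

/-- A measure on a product whose marginals are pushed forward along a measurable embedding `f`
is itself pushed forward along `Prod.map f f`. -/
theorem exists_map_prodMap_eq {f : A → B} (hf : MeasurableEmbedding f)
    {γ : Measure (B × B)} {μ ν : Measure A}
    (hfst : γ.map Prod.fst = μ.map f) (hsnd : γ.map Prod.snd = ν.map f) :
    ∃ γ' : Measure (A × A), γ'.map (Prod.map f f) = γ := by
  have range_ae (ρ : Measure A) : ∀ᵐ y ∂(ρ.map f), y ∈ Set.range f :=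
    (ae_map_iff hf.measurable.aemeasurable hf.measurableSet_range).2 (by simp)
  refine ⟨γ.comap (Prod.map f f), ?_⟩
  rw [(hf.prodMap hf).map_comap, Set.range_prodMap]
  refine Measure.restrict_eq_self_of_ae_mem ?_
  have h₁ : ∀ᵐ q ∂γ, q.1 ∈ Set.range f :=
    ae_of_ae_map measurable_fst.aemeasurable (hfst ▸ range_ae μ)
  have h₂ : ∀ᵐ q ∂γ, q.2 ∈ Set.range f :=
    ae_of_ae_map measurable_snd.aemeasurable (hsnd ▸ range_ae ν)
  filter_upwards [h₁, h₂] with q hq₁ hq₂ using ⟨hq₁, hq₂⟩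

theorem map_prodMap_fst {f : A → B} (hf : Measurable f) (γ : Measure (A × A)) :
    (γ.map (Prod.map f f)).map Prod.fst = (γ.map Prod.fst).map f := by
  rw [Measure.map_map measurable_fst (hf.prodMap hf), Measure.map_map hf measurable_fst]
  rfl

theorem map_prodMap_snd {f : A → B} (hf : Measurable f) (γ : Measure (A × A)) :
    (γ.map (Prod.map f f)).map Prod.snd = (γ.map Prod.snd).map f := by
  rw [Measure.map_map measurable_snd (hf.prodMap hf), Measure.map_map hf measurable_snd]
  rfl

theorem isCoupling_map_iff {f : A → B} (hf : MeasurableEmbedding f)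
    {γ : Measure (A × A)} {μ ν : Measure A} :
    IsCoupling (γ.map (Prod.map f f)) (μ.map f) (ν.map f) ↔ IsCoupling γ μ ν := by
  unfold IsCoupling
  rw [Measure.isProbabilityMeasure_map_iff (hf.prodMap hf).measurable.aemeasurable,
    map_prodMap_fst hf.measurable, map_prodMap_snd hf.measurable,
    hf.map_injective.eq_iff, hf.map_injective.eq_iff]

end Embedding

section Isometry

variable {A B : Type*} [MeasurableSpace A] [MeasurableSpace B]
  [PseudoMetricSpace A] [PseudoMetricSpace B]

theorem integrable_dist_map_prodMap_iff {f : A → B} (hf : MeasurableEmbedding f)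
    (hiso : Isometry f) {γ : Measure (A × A)} :
    Integrable (fun q : B × B => dist q.1 q.2) (γ.map (Prod.map f f)) ↔
      Integrable (fun q : A × A => dist q.1 q.2) γ := by
  rw [(hf.prodMap hf).integrable_map_iff]
  simp only [Function.comp_def, Prod.map_fst, Prod.map_snd, hiso.dist_eq]

theorem integral_dist_map_prodMap {f : A → B} (hf : MeasurableEmbedding f)
    (hiso : Isometry f) (γ : Measure (A × A)) :
    ∫ q, dist q.1 q.2 ∂(γ.map (Prod.map f f)) = ∫ q, dist q.1 q.2 ∂γ := by
  rw [(hf.prodMap hf).integral_map]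
  simp only [Prod.map_fst, Prod.map_snd, hiso.dist_eq]

/-- The Wasserstein distance is invariant under isometric measurable embeddings. -/
theorem W1_map {f : A → B} (hf : MeasurableEmbedding f) (hiso : Isometry f)
    (μ ν : Measure A) : W1 (μ.map f) (ν.map f) = W1 μ ν := by
  unfold W1
  congr 1
  ext r
  constructor
  · rintro ⟨γ, hγ, hint, hr⟩
    obtain ⟨γ, rfl⟩ := exists_map_prodMap_eq hf hγ.2.1 hγ.2.2
    exact ⟨γ, (isCoupling_map_iff hf).1 hγ, (integrable_dist_map_prodMap_iff hf hiso).1 hint,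
      (integral_dist_map_prodMap hf hiso γ).symm.trans hr⟩
  · rintro ⟨γ, hγ, hint, hr⟩
    exact ⟨γ.map (Prod.map f f), (isCoupling_map_iff hf).2 hγ,
      (integrable_dist_map_prodMap_iff hf hiso).2 hint,
      (integral_dist_map_prodMap hf hiso γ).trans hr⟩

end Isometry

/-- Reassembly is invariant under coordinatewise isometric measurable embeddings. -/
theorem isReassembly_map_iff {N : ℕ} {X Y : Fin N → Type*}
    [∀ i, MeasurableSpace (X i)] [∀ i, MetricSpace (X i)]
    [∀ i, MeasurableSpace (Y i)] [∀ i, MetricSpace (Y i)]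
    {f : ∀ i, X i → Y i} (hf : ∀ i, MeasurableEmbedding (f i)) (hiso : ∀ i, Isometry (f i))
    (hpi : MeasurableEmbedding (fun (x : ∀ i, X i) i => f i (x i)))
    (μhat μtilde : Measure (∀ i, X i)) (μ : ∀ i, Measure (X i)) :
    IsReassembly (μhat.map (fun x i => f i (x i))) (fun i => (μ i).map (f i))
      (μtilde.map (fun x i => f i (x i))) ↔ IsReassembly μhat μ μtilde := by
  set F : (∀ i, X i) → ∀ i, Y i := fun x i => f i (x i)
  have map_eval (ρ : Measure (∀ i, X i)) (i : Fin N) :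
      (ρ.map F).map (fun y => y i) = (ρ.map (fun x => x i)).map (f i) := by
    rw [Measure.map_map (measurable_pi_apply i) hpi.measurable,
      Measure.map_map (hf i).measurable (measurable_pi_apply i)]
    rfl
  have map_eval_pair (γ : Measure ((∀ i, X i) × (∀ i, X i))) (i : Fin N) :
      (γ.map (Prod.map F F)).map (fun q => (q.1 i, q.2 i)) =
        (γ.map (fun q => (q.1 i, q.2 i))).map (Prod.map (f i) (f i)) := by
    rw [Measure.map_map (by fun_prop) (hpi.prodMap hpi).measurable,
      Measure.map_map ((hf i).prodMap (hf i)).measurable (by fun_prop)]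
    rfl
  unfold IsReassembly
  refine and_congr ?_ ?_
  · unfold IsCouplingPi
    refine and_congr (Measure.isProbabilityMeasure_map_iff hpi.measurable.aemeasurable)
      (forall_congr' fun i => ?_)
    rw [map_eval, (hf i).map_injective.eq_iff]
  · have key (γ : Measure ((∀ i, X i) × (∀ i, X i))) :
        (IsProbabilityMeasure (γ.map (Prod.map F F)) ∧
          (γ.map (Prod.map F F)).map Prod.fst = μhat.map F ∧
          (γ.map (Prod.map F F)).map Prod.snd = μtilde.map F ∧
          ∀ i, IsCoupling ((γ.map (Prod.map F F)).map (fun q => (q.1 i, q.2 i)))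
              ((μhat.map F).map (fun y => y i)) ((μ i).map (f i)) ∧
            Integrable (fun q => dist q.1 q.2)
              ((γ.map (Prod.map F F)).map (fun q => (q.1 i, q.2 i))) ∧
            (∫ q, dist q.1 q.2 ∂((γ.map (Prod.map F F)).map (fun q => (q.1 i, q.2 i)))) =
              W1 ((μhat.map F).map (fun y => y i)) ((μ i).map (f i))) ↔
        (IsProbabilityMeasure γ ∧ γ.map Prod.fst = μhat ∧ γ.map Prod.snd = μtilde ∧
          ∀ i, IsCoupling (γ.map (fun q => (q.1 i, q.2 i))) (μhat.map (fun x => x i)) (μ i) ∧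
            Integrable (fun q => dist q.1 q.2) (γ.map (fun q => (q.1 i, q.2 i))) ∧
            (∫ q, dist q.1 q.2 ∂(γ.map (fun q => (q.1 i, q.2 i)))) =
              W1 (μhat.map (fun x => x i)) (μ i)) := by
      rw [Measure.isProbabilityMeasure_map_iff (hpi.prodMap hpi).measurable.aemeasurable,
        map_prodMap_fst hpi.measurable, map_prodMap_snd hpi.measurable,
        hpi.map_injective.eq_iff, hpi.map_injective.eq_iff]
      refine and_congr_right' (and_congr_right' (and_congr_right' (forall_congr' fun i => ?_)))
      rw [map_eval_pair, map_eval, isCoupling_map_iff (hf i),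
        integrable_dist_map_prodMap_iff (hf i) (hiso i),
        integral_dist_map_prodMap (hf i) (hiso i), W1_map (hf i) (hiso i)]
    constructor
    · rintro ⟨γ, hγ⟩
      obtain ⟨γ, rfl⟩ := exists_map_prodMap_eq hpi hγ.2.1 hγ.2.2.1
      exact ⟨γ, (key γ).1 hγ⟩
    · rintro ⟨γ, hγ⟩
      exact ⟨γ.map (Prod.map F F), (key γ).2 hγ⟩

/-- **Lemma 3.1**: the notion of reassembly is invariant under extension of the underlying
spaces.  If each `X_i = S_i` is a subspace of a Polish metric space `T_i` (with the
restricted metric), and measures are extended by `μ†(E) = μ(E ∩ S)` (i.e. pushforward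
along the inclusion), then `μ̃ ∈ R(μ̂; μ_1, …, μ_N)` iff `μ̃† ∈ R(μ̂†; μ_1†, …, μ_N†)`. -/
theorem reassembly_extension_iff {N : ℕ} {T : Fin N → Type*}
    [∀ i, MeasurableSpace (T i)] [∀ i, MetricSpace (T i)]
    [∀ i, PolishSpace (T i)] [∀ i, BorelSpace (T i)]
    (S : ∀ i, Set (T i))
    [∀ i, PolishSpace (S i)] [∀ i, BorelSpace (S i)]
    (μ : ∀ i, Measure (S i)) (hμprob : ∀ i, IsProbabilityMeasure (μ i))
    (hμP1 : ∀ i, HasFiniteFirstMoment (μ i))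
    (μhat μtilde : Measure (∀ i, S i))
    (hhatprob : IsProbabilityMeasure μhat) (htildeprob : IsProbabilityMeasure μtilde)
    (hhatP1 : ∃ x₀ : ∀ i, S i, Integrable (fun y => ∑ i, dist (x₀ i) (y i)) μhat)
    (htildeP1 : ∃ x₀ : ∀ i, S i, Integrable (fun y => ∑ i, dist (x₀ i) (y i)) μtilde) :
    IsReassembly μhat μ μtilde ↔
      IsReassembly (μhat.map (fun x i => (x i : T i)))
        (fun i => (μ i).map (Subtype.val : S i → T i))
        (μtilde.map (fun x i => (x i : T i))) := by
  have hval (i : Fin N) : MeasurableEmbedding (Subtype.val : S i → T i) :=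
    continuous_subtype_val.measurableEmbedding Subtype.val_injective
  have hpi : MeasurableEmbedding (fun (x : ∀ i, S i) i => (x i : T i)) :=
    Measurable.measurableEmbedding (by fun_prop)
      fun x y h => funext fun i => Subtype.ext (congrFun h i)
  exact (isReassembly_map_iff hval (fun _ => isometry_subtype_coe) hpi μhat μtilde μ).symm

end
end

section
/- Let m ∈ ℕ, p ∈ [1,∞), let ‖·‖ be a norm on ℝ^m, and let μ be a Borel probability measure on ℝ^m with finite p-th moment, with i-th one-dimensional marginals μ_i for i = 1,...,m. Let β > 0, and for each i let n_i ∈ ℕ, κ̲_i ∈ ℝ and κ_{i,j} := κ̲_i + jβ for j = 0,...,n_i. Define the finite collection G of Borel functions on ℝ^m by: G_0 := { x ↦ ( max_{i∈L} (x_i − κ_{i,j_i})^+ )^+ : j_i ∈ {0,...,n_i} for each i ∈ L, L ⊆ {1,...,m} }, and G := G_0 ∪ { x ↦ x_i : 1 ≤ i ≤ m } if p = 1, while G := G_0 ∪ { x ↦ ((κ_{i,0} − x_i)^+)^p : 1 ≤ i ≤ m } ∪ { x ↦ ((x_i − κ_{i,n_i})^+)^p : 1 ≤ i ≤ m } if p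 > 1. Let C ≥ 1 be a constant with ‖x‖ ≤ C‖x‖_p for all x ∈ ℝ^m. Then: (a) every Borel probability measure ν on ℝ^m with finite p-th moment satisfying ∫ |g|^p dν < ∞ and ∫ g dν = ∫ g dμ for all g ∈ G obeys W_p(μ,ν) ≤ 2 C m^{1/p} β + 2 C ( Σ_{i=1}^m ∫_ℝ ((κ_{i,0} − t)^+)^p + ((t − κ_{i,n_i})^+)^p μ_i(dt) )^{1/p}; and (b) for every ε > 0 there exist β > 0, (n_i)_{i=1}^m ⊂ ℕ and (κ̲_i)_{i=1}^m ⊂ ℝ such that the corresponding collection G satisfies sup{ W_p(μ,ν) : ν as above } ≤ ε. -/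
open MeasureTheory

noncomputable section

/-- The order-`p` Wasserstein distance on `ℝ^m` for the cost `Nm(x − y)^p`, where `Nm` is
a (possibly non-Euclidean) norm on `ℝ^m`. -/
def WpN (m : ℕ) (p : ℝ) (Nm : (Fin m → ℝ) → ℝ)
    (μ ν : Measure (Fin m → ℝ)) : ℝ :=
  sInf {r : ℝ | ∃ γ : Measure ((Fin m → ℝ) × (Fin m → ℝ)), IsProbabilityMeasure γ ∧
    γ.map Prod.fst = μ ∧ γ.map Prod.snd = ν ∧
    Integrable (fun q => Nm (q.1 - q.2) ^ p) γ ∧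
    (∫ q, Nm (q.1 - q.2) ^ p ∂γ) ^ (1 / p) = r}

/-- The collection `G` of test functions of Corollary 5.4: the best-of-call payoffs
`x ↦ (max_{i ∈ L} (x_i − κ_{i, j_i})⁺)⁺` for `L ⊆ {1, …, m}` and `0 ≤ j_i ≤ n_i`, where
`κ_{i,j} = κ̲_i + j β`, together with the coordinate functions if `p = 1`, or the power
put/call payoffs at the extreme strikes `κ_{i,0}`, `κ_{i,n_i}` if `p > 1`. -/
def bestOfCallG (m : ℕ) (p β : ℝ) (n : Fin m → ℕ) (κ : Fin m → ℝ) :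
    Set ((Fin m → ℝ) → ℝ) :=
  {h | ∃ (L : Finset (Fin m)) (jf : Fin m → ℕ), (∀ i ∈ L, jf i ≤ n i) ∧
      h = fun x => ⨆ i ∈ L, max (x i - (κ i + (jf i : ℝ) * β)) 0} ∪
  (if p = 1 then
    {h | ∃ i : Fin m, h = fun x => x i}
  else
    {h | ∃ i : Fin m, h = fun x => (max (κ i - x i) 0) ^ p} ∪
    {h | ∃ i : Fin m, h = fun x => (max (x i - (κ i + (n i : ℝ) * β)) 0) ^ p})

section Gluing

variable {A B Z : Type*} [MeasurableSpace A] [MeasurableSpace B] [MeasurableSpace Z]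

/-- The coupling of `P` and `Q` that is independent given the discrete labels `R` and `S`. -/
def labelCoupling (P : Measure A) (Q : Measure B) (R : A → Z) (S : B → Z) : Measure (A × B) :=
  Measure.sum fun z : Z =>
    (P (R ⁻¹' {z}))⁻¹ • (P.restrict (R ⁻¹' {z})).prod (Q.restrict (S ⁻¹' {z}))

theorem inv_smul_restrict_self (P : Measure A) [IsFiniteMeasure P] (s : Set A) :
    ((P s)⁻¹ * P s) • P.restrict s = P.restrict s := by
  by_cases h0 : P s = 0
  · rw [Measure.restrict_eq_zero.2 h0, smul_zero]
  · rw [ENNReal.inv_mul_cancel h0 (measure_ne_top P s), one_smul]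

variable [MeasurableSingletonClass Z] {P : Measure A} {Q : Measure B} {R : A → Z} {S : B → Z}

theorem fiber_measure_eq (hR : Measurable R) (hS : Measurable S) (h : P.map R = Q.map S) (z : Z) :
    P (R ⁻¹' {z}) = Q (S ⁻¹' {z}) := by
  rw [← Measure.map_apply hR (measurableSet_singleton z), h,
    Measure.map_apply hS (measurableSet_singleton z)]

variable [Countable Z]

theorem sum_restrict_fiber (P : Measure A) {R : A → Z} (hR : Measurable R) :
    (Measure.sum fun z : Z => P.restrict (R ⁻¹' {z})) = P := by
  rw [← Measure.restrict_iUnion]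
  · have : (⋃ z, R ⁻¹' {z}) = Set.univ := by ext; simp
    rw [this, Measure.restrict_univ]
  · intro z w hzw
    exact Disjoint.preimage R (by simpa using hzw)
  · exact fun z => hR (measurableSet_singleton z)

theorem labelCoupling_map_fst [IsFiniteMeasure P] [IsFiniteMeasure Q] (hR : Measurable R) (hS : Measurable S)
    (h : P.map R = Q.map S) : (labelCoupling P Q R S).map Prod.fst = P := by
  rw [labelCoupling, Measure.map_sum measurable_fst.aemeasurable]
  conv_rhs => rw [← sum_restrict_fiber P hR]
  congr 1
  funext z
  rw [Measure.map_smul, Measure.map_fst_prod, Measure.restrict_apply_univ,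
    ← fiber_measure_eq hR hS h z, smul_smul, inv_smul_restrict_self]

theorem labelCoupling_map_snd [IsFiniteMeasure Q] (hR : Measurable R) (hS : Measurable S)
    (h : P.map R = Q.map S) : (labelCoupling P Q R S).map Prod.snd = Q := by
  rw [labelCoupling, Measure.map_sum measurable_snd.aemeasurable]
  conv_rhs => rw [← sum_restrict_fiber Q hS]
  congr 1
  funext z
  rw [Measure.map_smul, Measure.map_snd_prod, Measure.restrict_apply_univ,
    fiber_measure_eq hR hS h z, smul_smul, inv_smul_restrict_self]

theorem labelCoupling_ae [IsFiniteMeasure P] [IsFiniteMeasure Q] (hR : Measurable R) (hS : Measurable S) :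
    ∀ᵐ q ∂(labelCoupling P Q R S), R q.1 = S q.2 := by
  rw [labelCoupling, Measure.ae_sum_iff]
  intro z
  refine Measure.ae_smul_measure ?_ _
  rw [Measure.prod_restrict]
  refine ae_restrict_of_forall_mem
    ((hR (measurableSet_singleton z)).prod (hS (measurableSet_singleton z))) ?_
  rintro q ⟨h1, h2⟩
  exact (show R q.1 = z from h1).trans (show S q.2 = z from h2).symm

end Gluing

section BestOfCall

variable {m : ℕ}

/-- The payoff of the best-of-call option on the assets in `L` with strikes `k`. -/
def bestCall (L : Finset (Fin m)) (k : Fin m → ℝ) (x : Fin m → ℝ) : ℝ :=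
  ⨆ i ∈ L, max (x i - k i) 0

theorem bestCall_nonneg (L : Finset (Fin m)) (k x : Fin m → ℝ) : 0 ≤ bestCall L k x :=
  Real.iSup_nonneg fun _ => Real.iSup_nonneg fun _ => le_max_right _ _

theorem bestCall_le_iff {L : Finset (Fin m)} {k x : Fin m → ℝ} {a : ℝ} (ha : 0 ≤ a) :
    bestCall L k x ≤ a ↔ ∀ i ∈ L, x i - k i ≤ a := by
  constructor
  · intro h i hi
    refine le_trans ?_ h
    calc x i - k i ≤ max (x i - k i) 0 := le_max_left _ _
      _ ≤ ⨆ _ : i ∈ L, max (x i - k i) 0 := le_ciSup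
          (f := fun _ : i ∈ L => max (x i - k i) 0) (Set.finite_range _).bddAbove hi
      _ ≤ bestCall L k x := le_ciSup
          (f := fun i => ⨆ _ : i ∈ L, max (x i - k i) 0) (Set.finite_range _).bddAbove i
  · intro h
    exact Real.iSup_le (fun i => Real.iSup_le (fun hi => max_le (h i hi) ha) ha) ha

theorem bestCall_add_strike (L : Finset (Fin m)) (k x : Fin m → ℝ) {β : ℝ} (hβ : 0 ≤ β) :
    bestCall L (fun i => k i + β) x = max (bestCall L k x - β) 0 := by
  refine eq_of_forall_ge_iff fun a => ?_
  by_cases ha : 0 ≤ a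
  · rw [bestCall_le_iff ha, max_le_iff, and_iff_left ha, sub_le_iff_le_add,
      bestCall_le_iff (add_nonneg ha hβ)]
    refine forall₂_congr fun i _ => ?_
    rw [← sub_sub, sub_le_iff_le_add]
  · have h1 := bestCall_nonneg L (fun i => k i + β) x
    exact iff_of_false (fun h => ha (h1.trans h)) fun h => ha ((le_max_right _ _).trans h)

theorem bestCall_singleton (i : Fin m) (k x : Fin m → ℝ) :
    bestCall {i} k x = max (x i - k i) 0 := by
  refine eq_of_forall_ge_iff fun a => ?_
  by_cases ha : 0 ≤ a
  · simp [bestCall_le_iff ha, ha]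
  · exact iff_of_false (fun h => ha ((bestCall_nonneg _ _ _).trans h))
      fun h => ha ((le_max_right _ _).trans h)

theorem bestCall_le_norm (L : Finset (Fin m)) (k x : Fin m → ℝ) :
    bestCall L k x ≤ ‖x‖ + ‖k‖ := by
  rw [bestCall_le_iff (by positivity)]
  intro i _
  have h1 := (le_abs_self (x i)).trans (norm_le_pi_norm x i)
  have h2 := (neg_abs_le (k i)).trans' (neg_le_neg (norm_le_pi_norm k i))
  linarith

theorem measurable_bestCall (L : Finset (Fin m)) (k : Fin m → ℝ) : Measurable (bestCall L k) := by
  refine Measurable.iSup fun i => Measurable.iSup fun _ => ?_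
  fun_prop

theorem integrable_bestCall {μ : Measure (Fin m → ℝ)} [IsFiniteMeasure μ]
    (hμ : Integrable (fun x => ‖x‖) μ) (L : Finset (Fin m)) (k : Fin m → ℝ) :
    Integrable (bestCall L k) μ := by
  refine (hμ.add (integrable_const ‖k‖)).mono' (measurable_bestCall L k).aestronglyMeasurable ?_
  refine Filter.Eventually.of_forall fun x => ?_
  rw [Real.norm_of_nonneg (bestCall_nonneg L k x)]
  exact bestCall_le_norm L k x

end BestOfCall

section Rounding

variable {m : ℕ}

/-- The index of the point of the grid `κ i + j * β`, `0 ≤ j ≤ n i`, to which `x` is rounded with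
the common threshold `u`. -/
def gridIndex (β : ℝ) (n : Fin m → ℕ) (κ : Fin m → ℝ) (q : (Fin m → ℝ) × ℝ) (i : Fin m) : ℕ :=
  min (n i) ⌈(q.1 i - κ i) / β - q.2⌉₊

theorem measurable_gridIndex (β : ℝ) (n : Fin m → ℕ) (κ : Fin m → ℝ) :
    Measurable (gridIndex β n κ) := by
  refine measurable_pi_lambda _ fun i => measurable_const.min (Nat.measurable_ceil.comp ?_)
  fun_prop

theorem abs_sub_gridIndex_le {β : ℝ} (hβ : 0 < β) (n : Fin m → ℕ) (κ : Fin m → ℝ)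
    {q : (Fin m → ℝ) × ℝ} (hq : q.2 ∈ Set.Ico (0 : ℝ) 1) (i : Fin m) :
    |q.1 i - (κ i + (gridIndex β n κ q i : ℝ) * β)| ≤
      β + (max (κ i - q.1 i) 0 + max (q.1 i - (κ i + (n i : ℝ) * β)) 0) := by
  obtain ⟨x, u⟩ := q
  obtain ⟨hu0, hu1⟩ := hq
  simp only at hu0 hu1 ⊢
  have e1 := le_max_left (κ i - x i) 0
  have e2 := le_max_right (κ i - x i) 0
  have e3 := le_max_left (x i - (κ i + (n i : ℝ) * β)) 0
  have e4 := le_max_right (x i - (κ i + (n i : ℝ) * β)) 0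
  set t := (x i - κ i) / β with ht
  have hx : x i = κ i + t * β := by rw [ht]; field_simp; ring
  set k := gridIndex β n κ (x, u) i with hk
  have hkdef : k = min (n i) ⌈t - u⌉₊ := rfl
  have hlow : k = 0 ∨ (k : ℝ) - 1 ≤ t := by
    rcases Nat.eq_zero_or_pos k with h | h
    · exact Or.inl h
    · right
      have h1 : k - 1 < ⌈t - u⌉₊ := by omega
      rw [Nat.lt_ceil, Nat.cast_sub h] at h1
      push_cast at h1
      linarith
  have hup : k = n i ∨ t ≤ k + 1 := by
    by_cases h : k = n i
    · exact Or.inl h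
    · right
      have h1 : ⌈t - u⌉₊ ≤ k := by omega
      rw [Nat.ceil_le] at h1
      linarith
  rw [abs_le]
  constructor
  · rcases hlow with h | h
    · rw [h]; push_cast; linarith
    · have := mul_le_mul_of_nonneg_right h hβ.le
      linarith
  · rcases hup with h | h
    · rw [h]; linarith
    · have := mul_le_mul_of_nonneg_right h hβ.le
      linarith

/-- The uniform distribution on `[0, 1)`. -/
def unifMeasure : Measure ℝ := volume.restrict (Set.Ico 0 1)

instance : IsProbabilityMeasure unifMeasure :=
  ⟨by simp [unifMeasure]⟩

theorem gridIndex_le_iff {β : ℝ} (hβ : 0 < β) (n : Fin m → ℕ) (κ : Fin m → ℝ) (l : Fin m → ℕ)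
    (x : Fin m → ℝ) {u : ℝ} (hu : 0 ≤ u) :
    (∀ i, gridIndex β n κ (x, u) i ≤ l i) ↔
      bestCall {i | l i < n i} (fun i => κ i + (l i : ℝ) * β) x ≤ u * β := by
  rw [bestCall_le_iff (by positivity)]
  simp only [Finset.mem_filter, Finset.mem_univ, true_and, gridIndex, min_le_iff, Nat.ceil_le]
  refine forall_congr' fun i => ?_
  rw [or_iff_not_imp_left, not_le, sub_le_iff_le_add, div_le_iff₀ hβ]
  refine imp_congr_right fun _ => ?_
  constructor <;> intro h <;> linarith

theorem unifMeasure_gridIndex_le {β : ℝ} (hβ : 0 < β) (n : Fin m → ℕ) (κ : Fin m → ℝ)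
    (l : Fin m → ℕ) (x : Fin m → ℝ) :
    unifMeasure {u | ∀ i, gridIndex β n κ (x, u) i ≤ l i} =
      ENNReal.ofReal (1 - (bestCall {i | l i < n i} (fun i => κ i + (l i : ℝ) * β) x -
        bestCall {i | l i < n i} (fun i => κ i + (l i : ℝ) * β + β) x) / β) := by
  rw [bestCall_add_strike _ _ _ hβ.le]
  have h0 := bestCall_nonneg {i | l i < n i} (fun i => κ i + (l i : ℝ) * β) x
  have hset : Set.Ico (0 : ℝ) 1 ∩ {u | ∀ i, gridIndex β n κ (x, u) i ≤ l i} =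
      Set.Ico (bestCall {i | l i < n i} (fun i => κ i + (l i : ℝ) * β) x / β) 1 := by
    ext u
    constructor
    · rintro ⟨⟨hu0, hu1⟩, hu⟩
      exact ⟨(div_le_iff₀ hβ).2 ((gridIndex_le_iff hβ n κ l x hu0).1 hu), hu1⟩
    · rintro ⟨hu, hu1⟩
      have hu0 : 0 ≤ u := (div_nonneg h0 hβ.le).trans hu
      exact ⟨⟨hu0, hu1⟩, (gridIndex_le_iff hβ n κ l x hu0).2 ((div_le_iff₀ hβ).1 hu)⟩
  rw [unifMeasure, Measure.restrict_apply' measurableSet_Ico, Set.inter_comm, hset,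
    Real.volume_Ico]
  set b := bestCall {i | l i < n i} (fun i => κ i + (l i : ℝ) * β) x
  rcases le_total b β with h | h
  · rw [max_eq_right (by linarith), sub_zero]
  · rw [max_eq_left (by linarith), sub_sub_cancel, div_self hβ.ne', sub_self,
      ENNReal.ofReal_of_nonpos, ENNReal.ofReal_zero]
    rw [sub_nonpos, le_div_iff₀ hβ]
    linarith

theorem prod_unif_gridIndex_le {μ : Measure (Fin m → ℝ)} [IsProbabilityMeasure μ]
    (hμ : Integrable (fun x => ‖x‖) μ) {β : ℝ} (hβ : 0 < β) (n : Fin m → ℕ) (κ : Fin m → ℝ)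
    (l : Fin m → ℕ) :
    (μ.prod unifMeasure) {q | ∀ i, gridIndex β n κ q i ≤ l i} =
      ENNReal.ofReal (1 -
        ((∫ x, bestCall {i | l i < n i} (fun i => κ i + (l i : ℝ) * β) x ∂μ) -
          ∫ x, bestCall {i | l i < n i} (fun i => κ i + (l i : ℝ) * β + β) x ∂μ) / β) := by
  have hmeas : MeasurableSet {q | ∀ i, gridIndex β n κ q i ≤ l i} := by
    have : {q | ∀ i, gridIndex β n κ q i ≤ l i} = gridIndex β n κ ⁻¹' {z | ∀ i, z i ≤ l i} := rfl
    rw [this]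
    exact measurable_gridIndex β n κ (Set.to_countable _).measurableSet
  have hint : Integrable (fun x => bestCall {i | l i < n i} (fun i => κ i + (l i : ℝ) * β) x -
      bestCall {i | l i < n i} (fun i => κ i + (l i : ℝ) * β + β) x) μ :=
    (integrable_bestCall hμ _ _).sub (integrable_bestCall hμ _ _)
  rw [Measure.prod_apply hmeas]
  simp only [Set.preimage_ofPred_eq, unifMeasure_gridIndex_le hβ]
  rw [← ofReal_integral_eq_lintegral_ofReal]
  · congr 1
    rw [integral_sub (integrable_const _) (hint.div_const β), integral_div]
    rw [integral_sub (integrable_bestCall hμ _ _) (integrable_bestCall hμ _ _)]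
    simp
  · exact (integrable_const _).sub (hint.div_const β)
  · refine Filter.Eventually.of_forall fun x => ?_
    simp only [Pi.zero_apply]
    rw [bestCall_add_strike _ _ _ hβ.le, sub_nonneg, div_le_one hβ]
    linarith [le_max_left (bestCall {i | l i < n i} (fun i => κ i + (l i : ℝ) * β) x - β) 0]

theorem measure_pi_nat_ext {P Q : Measure (Fin m → ℕ)} [IsProbabilityMeasure P]
    [IsProbabilityMeasure Q] (h : ∀ l : Fin m → ℕ, P {z | ∀ i, z i ≤ l i} = Q {z | ∀ i, z i ≤ l i}) :
    P = Q := by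
  have hspan : IsCountablySpanning (Set.range (Set.Iic : ℕ → Set ℕ)) :=
    ⟨fun k => Set.Iic k, fun k => ⟨k, rfl⟩, by ext k; simp⟩
  have hgen : (inferInstance : MeasurableSpace ℕ) =
      MeasurableSpace.generateFrom (Set.range (Set.Iic : ℕ → Set ℕ)) := by
    rw [← borel_eq_generateFrom_Iic]
    exact BorelSpace.measurable_eq
  refine ext_of_generate_finite
    (Set.univ.pi '' Set.univ.pi fun _ : Fin m => Set.range (Set.Iic : ℕ → Set ℕ)) ?_
    (IsPiSystem.pi fun _ => isPiSystem_Iic) ?_ (by simp)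
  · exact (generateFrom_eq_pi (fun _ => hgen.symm) fun _ => hspan).symm
  · rintro _ ⟨s, hs, rfl⟩
    choose l hl using fun i => hs i (Set.mem_univ i)
    have : Set.univ.pi s = {z | ∀ i, z i ≤ l i} := by
      ext z
      simp [← hl]
    rw [this]
    exact h l

end Rounding

section Norm

variable {m : ℕ} {p : ℝ} {Nm : (Fin m → ℝ) → ℝ}

theorem norm_fun_nonneg (hNm_add : ∀ x y, Nm (x + y) ≤ Nm x + Nm y)
    (hNm_smul : ∀ (c : ℝ) (x), Nm (c • x) = |c| * Nm x) (x : Fin m → ℝ) : 0 ≤ Nm x := by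
  have h0 : Nm 0 = 0 := by simpa using hNm_smul 0 0
  have h1 : Nm (-x) = Nm x := by simpa using hNm_smul (-1) x
  have h2 := hNm_add x (-x)
  rw [add_neg_cancel, h0, h1] at h2
  linarith

theorem continuous_norm_fun (hp : 1 ≤ p) (hNm_add : ∀ x y, Nm (x + y) ≤ Nm x + Nm y)
    (hNm_smul : ∀ (c : ℝ) (x), Nm (c • x) = |c| * Nm x) {C : ℝ}
    (hCnorm : ∀ x, Nm x ≤ C * (∑ i, |x i| ^ p) ^ (1 / p)) : Continuous Nm := by
  have hp0 : 0 < p := by linarith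
  rw [continuous_iff_continuousAt]
  intro x
  rw [ContinuousAt, tendsto_iff_dist_tendsto_zero]
  have hlim : Filter.Tendsto (fun y : Fin m → ℝ => C * (∑ i, |y i - x i| ^ p) ^ (1 / p))
      (nhds x) (nhds 0) := by
    have hc : Continuous fun y : Fin m → ℝ => C * (∑ i, |y i - x i| ^ p) ^ (1 / p) := by
      refine continuous_const.mul (Continuous.rpow_const ?_ fun _ => Or.inr (by positivity))
      refine continuous_finsetSum _ fun i _ => ?_
      exact Continuous.rpow_const (by fun_prop) fun _ => Or.inr hp0.le
    have := hc.tendsto x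
    simpa [Real.zero_rpow hp0.ne', Real.zero_rpow (inv_ne_zero hp0.ne')] using this
  refine squeeze_zero (fun _ => dist_nonneg) (fun y => ?_) hlim
  refine le_trans ?_ (hCnorm (y - x))
  rw [Real.dist_eq, abs_le]
  have h1 := hNm_add (y - x) x
  have h2 := hNm_add (x - y) y
  have h3 : Nm (x - y) = Nm (y - x) := by simpa using hNm_smul (-1) (y - x)
  rw [sub_add_cancel] at h1 h2
  constructor <;> linarith

theorem exists_mul_norm_le (hNm_add : ∀ x y, Nm (x + y) ≤ Nm x + Nm y)
    (hNm_smul : ∀ (c : ℝ) (x), Nm (c • x) = |c| * Nm x) (hNm_def : ∀ x, Nm x = 0 → x = 0)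
    (hcont : Continuous Nm) : ∃ c > 0, ∀ x, ‖x‖ ≤ c * Nm x := by
  have key : ∃ a > 0, ∀ x ∈ Metric.sphere (0 : Fin m → ℝ) 1, a ≤ Nm x := by
    rcases (Metric.sphere (0 : Fin m → ℝ) 1).eq_empty_or_nonempty with h | h
    · exact ⟨1, one_pos, by simp [h]⟩
    · obtain ⟨z, hz, hmin⟩ := (isCompact_sphere (0 : Fin m → ℝ) 1).exists_isMinOn h
        hcont.continuousOn
      refine ⟨Nm z, lt_of_le_of_ne (norm_fun_nonneg hNm_add hNm_smul z) fun h0 => ?_,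
        fun x hx => hmin hx⟩
      rw [hNm_def z h0.symm] at hz
      simp at hz
  obtain ⟨a, ha, h⟩ := key
  refine ⟨a⁻¹, inv_pos.2 ha, fun x => ?_⟩
  rw [inv_mul_eq_div, le_div_iff₀ ha]
  by_cases hx : x = 0
  · simpa [hx] using norm_fun_nonneg hNm_add hNm_smul 0
  · have hx' : 0 < ‖x‖ := norm_pos_iff.2 hx
    have := h (‖x‖⁻¹ • x) (by simp [norm_smul, hx'.ne'])
    rw [hNm_smul, abs_of_pos (inv_pos.2 hx'), inv_mul_eq_div, le_div_iff₀ hx'] at this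
    linarith

theorem integrable_norm_rpow_of_le (hp : 1 ≤ p) {c : ℝ} (hc : ∀ x, ‖x‖ ≤ c * Nm x) (hc0 : 0 < c)
    (hNm : ∀ x, 0 ≤ Nm x) {μ : Measure (Fin m → ℝ)} (h : Integrable (fun x => Nm x ^ p) μ) :
    Integrable (fun x => ‖x‖ ^ p) μ := by
  have hp0 : 0 ≤ p := by linarith
  refine (h.const_mul (c ^ p)).mono' (by fun_prop) (Filter.Eventually.of_forall fun x => ?_)
  rw [Real.norm_of_nonneg (by positivity), ← Real.mul_rpow hc0.le (hNm x)]
  exact Real.rpow_le_rpow (norm_nonneg x) (hc x) hp0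

theorem integrable_norm_of_rpow (hp : 1 ≤ p) {μ : Measure (Fin m → ℝ)} [IsFiniteMeasure μ]
    (h : Integrable (fun x => ‖x‖ ^ p) μ) : Integrable (fun x => ‖x‖) μ := by
  refine (h.add (integrable_const 1)).mono' (by fun_prop) (Filter.Eventually.of_forall fun x => ?_)
  rw [norm_norm, Pi.add_apply]
  rcases le_total ‖x‖ 1 with hx | hx
  · have : 0 ≤ ‖x‖ ^ p := by positivity
    linarith
  · have := Real.self_le_rpow_of_one_le hx hp
    linarith

end Norm

section Excess

variable {m : ℕ} {p : ℝ}

/-- The distance of `t` to the interval `[a, b]`. -/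
def excess (a b t : ℝ) : ℝ := max (a - t) 0 + max (t - b) 0

theorem excess_nonneg (a b t : ℝ) : 0 ≤ excess a b t :=
  add_nonneg (le_max_right _ _) (le_max_right _ _)

theorem excess_rpow (hp : 0 < p) {a b : ℝ} (hab : a ≤ b) (t : ℝ) :
    excess a b t ^ p = max (a - t) 0 ^ p + max (t - b) 0 ^ p := by
  rcases le_total a t with h | h
  · rw [excess, max_eq_right (sub_nonpos.2 h), Real.zero_rpow hp.ne', zero_add, zero_add]
  · rw [excess, max_eq_right (sub_nonpos.2 (h.trans hab)), Real.zero_rpow hp.ne', add_zero, add_zero]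

/-- The `p`-norm distance of `x` to the box with corners `a` and `b`. -/
def boxExcess (p : ℝ) (a b x : Fin m → ℝ) : ℝ := (∑ i, excess (a i) (b i) (x i) ^ p) ^ (1 / p)

theorem boxExcess_nonneg (p : ℝ) (a b x : Fin m → ℝ) : 0 ≤ boxExcess p a b x :=
  Real.rpow_nonneg (Finset.sum_nonneg fun _ _ => Real.rpow_nonneg (excess_nonneg _ _ _) _) _

theorem boxExcess_rpow (hp : 0 < p) (a b x : Fin m → ℝ) :
    boxExcess p a b x ^ p = ∑ i, excess (a i) (b i) (x i) ^ p := by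
  rw [boxExcess, one_div, Real.rpow_inv_rpow _ hp.ne']
  exact Finset.sum_nonneg fun _ _ => Real.rpow_nonneg (excess_nonneg _ _ _) _

theorem continuous_max_sub_left_rpow (hp : 0 ≤ p) (a : ℝ) (i : Fin m) :
    Continuous fun x : Fin m → ℝ => max (a - x i) 0 ^ p :=
  Continuous.rpow_const (by fun_prop) fun _ => Or.inr hp

theorem continuous_max_sub_right_rpow (hp : 0 ≤ p) (a : ℝ) (i : Fin m) :
    Continuous fun x : Fin m → ℝ => max (x i - a) 0 ^ p :=
  Continuous.rpow_const (by fun_prop) fun _ => Or.inr hp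

theorem integrable_of_le_norm_add (hp : 1 ≤ p) {μ : Measure (Fin m → ℝ)} [IsFiniteMeasure μ]
    (h : Integrable (fun x => ‖x‖ ^ p) μ) {f : (Fin m → ℝ) → ℝ} (hf : Continuous f)
    (hf0 : ∀ x, 0 ≤ f x) {a : ℝ} (ha : 0 ≤ a) (hfa : ∀ x, f x ≤ (‖x‖ + a) ^ p) :
    Integrable f μ := by
  refine ((h.add (integrable_const (a ^ p))).const_mul (2 ^ (p - 1))).mono'
    hf.aestronglyMeasurable (Filter.Eventually.of_forall fun x => ?_)
  rw [Real.norm_of_nonneg (hf0 x)]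
  refine (hfa x).trans ?_
  exact_mod_cast NNReal.rpow_add_le_mul_rpow_add_rpow ‖x‖₊ ⟨a, ha⟩ hp

theorem integrable_max_sub_left_rpow (hp : 1 ≤ p) {μ : Measure (Fin m → ℝ)} [IsFiniteMeasure μ]
    (h : Integrable (fun x => ‖x‖ ^ p) μ) (a : ℝ) (i : Fin m) :
    Integrable (fun x => max (a - x i) 0 ^ p) μ := by
  refine integrable_of_le_norm_add hp h (continuous_max_sub_left_rpow (by linarith) a i)
    (fun x => by positivity) (abs_nonneg a) fun x => ?_
  refine Real.rpow_le_rpow (le_max_right _ _) (max_le ?_ (by positivity)) (by linarith)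
  have h1 := (neg_abs_le (x i)).trans' (neg_le_neg (norm_le_pi_norm x i))
  linarith [le_abs_self a]

theorem integrable_max_sub_right_rpow (hp : 1 ≤ p) {μ : Measure (Fin m → ℝ)} [IsFiniteMeasure μ]
    (h : Integrable (fun x => ‖x‖ ^ p) μ) (a : ℝ) (i : Fin m) :
    Integrable (fun x => max (x i - a) 0 ^ p) μ := by
  refine integrable_of_le_norm_add hp h (continuous_max_sub_right_rpow (by linarith) a i)
    (fun x => by positivity) (abs_nonneg a) fun x => ?_
  refine Real.rpow_le_rpow (le_max_right _ _) (max_le ?_ (by positivity)) (by linarith)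
  have h1 := (le_abs_self (x i)).trans (norm_le_pi_norm x i)
  linarith [neg_abs_le a]

theorem continuous_boxExcess (hp : 1 ≤ p) (a b : Fin m → ℝ) : Continuous (boxExcess p a b) := by
  have hp0 : 0 < p := by linarith
  refine Continuous.rpow_const (continuous_finsetSum _ fun i _ => ?_)
    fun _ => Or.inr (by positivity)
  unfold excess
  exact Continuous.rpow_const (by fun_prop) fun _ => Or.inr hp0.le

variable {a b : Fin m → ℝ} {μ : Measure (Fin m → ℝ)}

theorem integrable_boxExcess_rpow [IsFiniteMeasure μ] (hp : 1 ≤ p) (hab : ∀ i, a i ≤ b i)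
    (h : Integrable (fun x => ‖x‖ ^ p) μ) : Integrable (fun x => boxExcess p a b x ^ p) μ := by
  have hp0 : 0 < p := by linarith
  simp only [boxExcess_rpow hp0, fun x i => excess_rpow hp0 (hab i) x]
  exact integrable_finsetSum _ fun i _ =>
    (integrable_max_sub_left_rpow hp h _ i).add (integrable_max_sub_right_rpow hp h _ i)

theorem integral_boxExcess_rpow [IsFiniteMeasure μ] (hp : 1 ≤ p) (hab : ∀ i, a i ≤ b i)
    (h : Integrable (fun x => ‖x‖ ^ p) μ) :
    ∫ x, boxExcess p a b x ^ p ∂μ =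
      ∑ i, ((∫ x, max (a i - x i) 0 ^ p ∂μ) + ∫ x, max (x i - b i) 0 ^ p ∂μ) := by
  have hp0 : 0 < p := by linarith
  simp only [boxExcess_rpow hp0, fun x i => excess_rpow hp0 (hab i) x]
  rw [integral_finsetSum]
  · refine Finset.sum_congr rfl fun i _ => ?_
    exact integral_add (integrable_max_sub_left_rpow hp h _ i)
      (integrable_max_sub_right_rpow hp h _ i)
  · exact fun i _ =>
      (integrable_max_sub_left_rpow hp h _ i).add (integrable_max_sub_right_rpow hp h _ i)

theorem integral_map_max_rpow (hp : 1 ≤ p) (a b : ℝ) (i : Fin m) :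
    ∫ t, (max (a - t) 0 ^ p + max (t - b) 0 ^ p) ∂(μ.map fun x => x i) =
      ∫ x, (max (a - x i) 0 ^ p + max (x i - b) 0 ^ p) ∂μ := by
  refine integral_map (measurable_pi_apply i).aemeasurable (Continuous.aestronglyMeasurable ?_)
  have hp0 : 0 ≤ p := by linarith
  exact (Continuous.rpow_const (by fun_prop) fun _ => Or.inr hp0).add
    (Continuous.rpow_const (by fun_prop) fun _ => Or.inr hp0)

theorem sum_integral_map_eq [IsFiniteMeasure μ] (hp : 1 ≤ p) (hab : ∀ i, a i ≤ b i)
    (h : Integrable (fun x => ‖x‖ ^ p) μ) :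
    ∑ i, ∫ t, (max (a i - t) 0 ^ p + max (t - b i) 0 ^ p) ∂(μ.map fun x => x i) =
      ∫ x, boxExcess p a b x ^ p ∂μ := by
  rw [integral_boxExcess_rpow hp hab h]
  refine Finset.sum_congr rfl fun i _ => ?_
  rw [integral_map_max_rpow hp]
  exact integral_add (integrable_max_sub_left_rpow hp h _ i)
    (integrable_max_sub_right_rpow hp h _ i)

theorem integral_boxExcess_rpow_tendsto {β : ℝ} (hβ : 0 < β) (hp : 1 ≤ p)
    (h : Integrable (fun x => ‖x‖ ^ p) μ) :
    Filter.Tendsto (fun N : ℕ => ∫ x, boxExcess p (fun _ : Fin m => -(N * β)) (fun _ => N * β) x ^ p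
      ∂μ) Filter.atTop (nhds 0) := by
  have hp0 : 0 < p := by linarith
  have hb : ∀ (N : ℕ) (x : Fin m → ℝ) (i : Fin m),
      excess (-(N * β)) (N * β) (x i) ≤ max (‖x‖ - N * β) 0 := by
    intro N x i
    have h1 := norm_le_pi_norm x i
    rw [Real.norm_eq_abs] at h1
    have h2 := neg_abs_le (x i)
    have h3 := le_abs_self (x i)
    have h4 : 0 ≤ (N : ℝ) * β := by positivity
    have h5 := le_max_right (‖x‖ - N * β) 0
    have h6 := le_max_left (‖x‖ - N * β) 0
    unfold excess
    rcases max_cases (-(N * β) - x i) 0 with ⟨e1, e2⟩ | ⟨e1, e2⟩ <;>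
      rcases max_cases (x i - N * β) 0 with ⟨e3, e4⟩ | ⟨e3, e4⟩ <;> linarith
  have hle : ∀ (N : ℕ) (x : Fin m → ℝ),
      boxExcess p (fun _ : Fin m => -(N * β)) (fun _ => N * β) x ^ p ≤
        m * max (‖x‖ - N * β) 0 ^ p := by
    intro N x
    rw [boxExcess_rpow hp0]
    refine (Finset.sum_le_card_nsmul _ _ (max (‖x‖ - N * β) 0 ^ p) fun i _ => ?_).trans (by simp)
    exact Real.rpow_le_rpow (excess_nonneg _ _ _) (hb N x i) hp0.le
  rw [← integral_zero (Fin m → ℝ) ℝ (μ := μ)]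
  refine tendsto_integral_of_dominated_convergence (fun x => m * ‖x‖ ^ p) (fun N => ?_)
    (h.const_mul _) (fun N => ?_) ?_
  · exact ((continuous_boxExcess hp _ _).rpow_const fun _ => Or.inr hp0.le).aestronglyMeasurable
  · refine Filter.Eventually.of_forall fun x => ?_
    rw [Real.norm_of_nonneg (Real.rpow_nonneg (boxExcess_nonneg _ _ _ _) _)]
    refine (hle N x).trans ?_
    gcongr
    refine max_le ?_ (norm_nonneg x)
    have : 0 ≤ (N : ℝ) * β := by positivity
    linarith
  · refine Filter.Eventually.of_forall fun x => tendsto_const_nhds.congr' ?_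
    obtain ⟨K, hK⟩ := exists_nat_gt (‖x‖ / β)
    filter_upwards [Filter.eventually_ge_atTop K] with N hN
    refine le_antisymm (Real.rpow_nonneg (boxExcess_nonneg _ _ _ _) _) ((hle N x).trans ?_)
    have h1 : ‖x‖ ≤ N * β := by
      rw [div_lt_iff₀ hβ] at hK
      exact hK.le.trans (by gcongr)
    rw [max_eq_right (by linarith), Real.zero_rpow hp0.ne', mul_zero]

end Excess

section Coupling

variable {m : ℕ} {p : ℝ}

theorem exists_grid_coupling {μ ν : Measure (Fin m → ℝ)} [IsProbabilityMeasure μ]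
    [IsProbabilityMeasure ν] (hμ : Integrable (fun x => ‖x‖) μ)
    (hν : Integrable (fun x => ‖x‖) ν) {β : ℝ} (hβ : 0 < β) (n : Fin m → ℕ) (κ : Fin m → ℝ)
    (h : ∀ (L : Finset (Fin m)) (j : Fin m → ℕ), (∀ i ∈ L, j i ≤ n i) →
      ∫ x, bestCall L (fun i => κ i + (j i : ℝ) * β) x ∂ν =
        ∫ x, bestCall L (fun i => κ i + (j i : ℝ) * β) x ∂μ) :
    ∃ γ : Measure ((Fin m → ℝ) × (Fin m → ℝ)), IsProbabilityMeasure γ ∧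
      γ.map Prod.fst = μ ∧ γ.map Prod.snd = ν ∧
      ∀ᵐ q ∂γ, ∀ i, |q.1 i - q.2 i| ≤
        2 * β + (excess (κ i) (κ i + (n i : ℝ) * β) (q.1 i) +
          excess (κ i) (κ i + (n i : ℝ) * β) (q.2 i)) := by
  have hR := measurable_gridIndex β n κ
  have hmap : (μ.prod unifMeasure).map (gridIndex β n κ) =
      (ν.prod unifMeasure).map (gridIndex β n κ) := by
    have := Measure.isProbabilityMeasure_map (μ := μ.prod unifMeasure) hR.aemeasurable
    have := Measure.isProbabilityMeasure_map (μ := ν.prod unifMeasure) hR.aemeasurable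
    refine measure_pi_nat_ext fun l => ?_
    have hms : MeasurableSet {z : Fin m → ℕ | ∀ i, z i ≤ l i} :=
      (Set.to_countable _).measurableSet
    rw [Measure.map_apply hR hms, Measure.map_apply hR hms]
    simp only [Set.preimage_ofPred_eq]
    rw [prod_unif_gridIndex_le hμ hβ, prod_unif_gridIndex_le hν hβ]
    have h1 := h {i | l i < n i} l fun i hi => by
      simp only [Finset.mem_filter, Finset.mem_univ, true_and] at hi
      exact hi.le
    have h2 := h {i | l i < n i} (fun i => l i + 1) fun i hi => by
      simp only [Finset.mem_filter, Finset.mem_univ, true_and] at hi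
      exact hi
    simp only [Nat.cast_add, Nat.cast_one, add_mul, one_mul, ← add_assoc] at h2
    rw [h1, h2]
  set Γ := labelCoupling (μ.prod unifMeasure) (ν.prod unifMeasure) (gridIndex β n κ)
    (gridIndex β n κ) with hΓ
  have hfst : Γ.map Prod.fst = μ.prod unifMeasure := labelCoupling_map_fst hR hR hmap
  have hsnd : Γ.map Prod.snd = ν.prod unifMeasure := labelCoupling_map_snd hR hR hmap
  have hΓprob : IsProbabilityMeasure Γ := by
    constructor
    rw [← Set.preimage_univ (f := Prod.fst), ← Measure.map_apply measurable_fst .univ, hfst]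
    exact measure_univ
  have hu : ∀ ρ : Measure (Fin m → ℝ), ∀ᵐ a ∂(ρ.prod unifMeasure), a.2 ∈ Set.Ico (0 : ℝ) 1 :=
    fun ρ => Measure.quasiMeasurePreserving_snd.ae (ae_restrict_mem measurableSet_Ico)
  have hu1 : ∀ᵐ q ∂Γ, q.1.2 ∈ Set.Ico (0 : ℝ) 1 :=
    ae_of_ae_map measurable_fst.aemeasurable (by rw [hfst]; exact hu μ)
  have hu2 : ∀ᵐ q ∂Γ, q.2.2 ∈ Set.Ico (0 : ℝ) 1 :=
    ae_of_ae_map measurable_snd.aemeasurable (by rw [hsnd]; exact hu ν)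
  have hpr : Measurable (Prod.map Prod.fst Prod.fst :
      ((Fin m → ℝ) × ℝ) × ((Fin m → ℝ) × ℝ) → (Fin m → ℝ) × (Fin m → ℝ)) := by fun_prop
  refine ⟨Γ.map (Prod.map Prod.fst Prod.fst), Measure.isProbabilityMeasure_map hpr.aemeasurable,
    ?_, ?_, ?_⟩
  · rw [Measure.map_map measurable_fst hpr, Prod.map_fst', ← Measure.map_map measurable_fst
      measurable_fst, hfst, Measure.map_fst_prod, measure_univ, one_smul]
  · rw [Measure.map_map measurable_snd hpr, Prod.map_snd', ← Measure.map_map measurable_fst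
      measurable_snd, hsnd, Measure.map_fst_prod, measure_univ, one_smul]
  · have hms : MeasurableSet {q : (Fin m → ℝ) × (Fin m → ℝ) | ∀ i, |q.1 i - q.2 i| ≤
        2 * β + (excess (κ i) (κ i + (n i : ℝ) * β) (q.1 i) +
          excess (κ i) (κ i + (n i : ℝ) * β) (q.2 i))} := by
      simp only [Set.ofPred_forall]
      unfold excess
      exact MeasurableSet.iInter fun i => measurableSet_le (by fun_prop) (by fun_prop)
    rw [ae_map_iff hpr.aemeasurable hms]
    filter_upwards [hu1, hu2, labelCoupling_ae (P := μ.prod unifMeasure)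
      (Q := ν.prod unifMeasure) hR hR] with q h1 h2 h3 i
    have e1 := abs_sub_gridIndex_le hβ n κ h1 i
    have e2 := abs_sub_gridIndex_le hβ n κ h2 i
    rw [h3] at e1
    rw [abs_sub_comm] at e2
    have e3 := abs_sub_le (q.1.1 i) (κ i + (gridIndex β n κ q.2 i : ℝ) * β) (q.2.1 i)
    simp only [Prod.map_fst, Prod.map_snd]
    unfold excess
    linarith

theorem sum_abs_rpow_le (hp : 1 ≤ p) {a b x y : Fin m → ℝ} {β : ℝ} (hβ : 0 ≤ β)
    (h : ∀ i, |x i - y i| ≤ 2 * β + (excess (a i) (b i) (x i) + excess (a i) (b i) (y i))) :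
    (∑ i, |x i - y i| ^ p) ^ (1 / p) ≤
      2 * (m : ℝ) ^ (1 / p) * β + (boxExcess p a b x + boxExcess p a b y) := by
  have hp0 : 0 < p := by linarith
  have hex := fun (z : Fin m → ℝ) (i : Fin m) => excess_nonneg (a i) (b i) (z i)
  calc (∑ i, |x i - y i| ^ p) ^ (1 / p)
      ≤ (∑ i, (2 * β + (excess (a i) (b i) (x i) + excess (a i) (b i) (y i))) ^ p) ^ (1 / p) := by
        gcongr with i
        exact h i
    _ ≤ (∑ _i : Fin m, (2 * β) ^ p) ^ (1 / p) +
        (∑ i, (excess (a i) (b i) (x i) + excess (a i) (b i) (y i)) ^ p) ^ (1 / p) :=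
        Real.Lp_add_le_of_nonneg _ hp (fun _ _ => by positivity)
          fun i _ => add_nonneg (hex x i) (hex y i)
    _ ≤ _ := by
        refine add_le_add (le_of_eq ?_)
          (Real.Lp_add_le_of_nonneg _ hp (fun i _ => hex x i) fun i _ => hex y i)
        rw [Finset.sum_const, Finset.card_univ, Fintype.card_fin, nsmul_eq_mul,
          Real.mul_rpow (by positivity) (by positivity), one_div,
          Real.rpow_rpow_inv (by positivity) hp0.ne']
        ring

theorem memLp_of_integrable_rpow {α : Type*} [MeasurableSpace α] {γ : Measure α} (hp : 1 ≤ p)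
    {f : α → ℝ} (hf0 : ∀ x, 0 ≤ f x) (hfm : AEStronglyMeasurable f γ)
    (hf : Integrable (fun x => f x ^ p) γ) : MemLp f (ENNReal.ofReal p) γ := by
  have hp0 : 0 < p := by linarith
  rw [← integrable_norm_rpow_iff hfm (by simpa using hp0) ENNReal.ofReal_ne_top,
    ENNReal.toReal_ofReal hp0.le]
  simpa only [Real.norm_of_nonneg (hf0 _)] using hf

theorem toReal_eLpNorm_eq {α : Type*} [MeasurableSpace α] {γ : Measure α} (hp : 1 ≤ p)
    {f : α → ℝ} (hf0 : ∀ x, 0 ≤ f x) (hf : MemLp f (ENNReal.ofReal p) γ) :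
    (eLpNorm f (ENNReal.ofReal p) γ).toReal = (∫ x, f x ^ p ∂γ) ^ (1 / p) := by
  have hp0 : 0 < p := by linarith
  rw [hf.eLpNorm_eq_integral_rpow_norm (by simpa using hp0) ENNReal.ofReal_ne_top,
    ENNReal.toReal_ofReal hp0.le, one_div]
  simp only [Real.norm_of_nonneg (hf0 _)]
  exact ENNReal.toReal_ofReal
    (Real.rpow_nonneg (integral_nonneg fun x => Real.rpow_nonneg (hf0 x) _) _)

theorem Lp_bound_of_ae_le {α : Type*} [MeasurableSpace α] {γ : Measure α} [IsProbabilityMeasure γ]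
    (hp : 1 ≤ p) {F A B : α → ℝ} {c C : ℝ} (hc : 0 ≤ c) (hC : 0 ≤ C) (hF0 : ∀ x, 0 ≤ F x)
    (hA0 : ∀ x, 0 ≤ A x) (hB0 : ∀ x, 0 ≤ B x) (hFm : AEStronglyMeasurable F γ)
    (hA : MemLp A (ENNReal.ofReal p) γ) (hB : MemLp B (ENNReal.ofReal p) γ)
    (h : ∀ᵐ x ∂γ, F x ≤ C * (c + (A x + B x))) :
    Integrable (fun x => F x ^ p) γ ∧
      (∫ x, F x ^ p ∂γ) ^ (1 / p) ≤
        C * (c + ((∫ x, A x ^ p ∂γ) ^ (1 / p) + (∫ x, B x ^ p ∂γ) ^ (1 / p))) := by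
  have hp0 : 0 < p := by linarith
  have hP : 1 ≤ ENNReal.ofReal p := by simpa using hp
  have hconst : MemLp (fun _ : α => c) (ENNReal.ofReal p) γ := memLp_const c
  have hG := (hconst.add (hA.add hB)).const_mul C
  have hle : eLpNorm F (ENNReal.ofReal p) γ ≤ ENNReal.ofReal C *
      (eLpNorm (fun _ : α => c) (ENNReal.ofReal p) γ +
        (eLpNorm A (ENNReal.ofReal p) γ + eLpNorm B (ENNReal.ofReal p) γ)) := by
    calc eLpNorm F (ENNReal.ofReal p) γ
        ≤ eLpNorm (C • ((fun _ : α => c) + (A + B))) (ENNReal.ofReal p) γ := by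
          refine eLpNorm_mono_ae_real ?_
          filter_upwards [h] with x hx
          rw [Real.norm_of_nonneg (hF0 x)]
          exact hx
      _ = ENNReal.ofReal C * eLpNorm ((fun _ : α => c) + (A + B)) (ENNReal.ofReal p) γ := by
          rw [eLpNorm_const_smul, Real.enorm_of_nonneg hC]
      _ ≤ _ := by
          gcongr
          refine (eLpNorm_add_le hconst.1 (hA.add hB).1 hP).trans ?_
          gcongr
          exact eLpNorm_add_le hA.1 hB.1 hP
  have hF : MemLp F (ENNReal.ofReal p) γ := by
    refine ⟨hFm, hle.trans_lt ?_⟩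
    exact ENNReal.mul_lt_top ENNReal.ofReal_lt_top
      (ENNReal.add_lt_top.2 ⟨hconst.2, ENNReal.add_lt_top.2 ⟨hA.2, hB.2⟩⟩)
  refine ⟨?_, ?_⟩
  · have := hF.integrable_norm_rpow (by simpa using hp0) ENNReal.ofReal_ne_top
    rw [ENNReal.toReal_ofReal hp0.le] at this
    simpa only [Real.norm_of_nonneg (hF0 _)] using this
  · have hfin : eLpNorm A (ENNReal.ofReal p) γ + eLpNorm B (ENNReal.ofReal p) γ ≠ ⊤ :=
      ENNReal.add_ne_top.2 ⟨hA.2.ne, hB.2.ne⟩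
    have := ENNReal.toReal_mono (ENNReal.mul_ne_top ENNReal.ofReal_ne_top
      (ENNReal.add_ne_top.2 ⟨hconst.2.ne, hfin⟩)) hle
    rw [ENNReal.toReal_mul, ENNReal.toReal_add hconst.2.ne hfin,
      ENNReal.toReal_add hA.2.ne hB.2.ne, ENNReal.toReal_ofReal hC, toReal_eLpNorm_eq hp hF0 hF,
      toReal_eLpNorm_eq hp hA0 hA, toReal_eLpNorm_eq hp hB0 hB,
      toReal_eLpNorm_eq hp (fun _ => hc) hconst] at this
    simpa [Real.rpow_rpow_inv hc hp0.ne'] using this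

theorem WpN_le_of_coupling (hp : 1 ≤ p) {Nm : (Fin m → ℝ) → ℝ} (hNm0 : ∀ x, 0 ≤ Nm x)
    (hcont : Continuous Nm) {C : ℝ} (hC : 0 ≤ C)
    (hCnorm : ∀ x, Nm x ≤ C * (∑ i, |x i| ^ p) ^ (1 / p)) {μ ν : Measure (Fin m → ℝ)}
    [IsFiniteMeasure μ] [IsFiniteMeasure ν] (hμ : Integrable (fun x => ‖x‖ ^ p) μ)
    (hν : Integrable (fun x => ‖x‖ ^ p) ν) {β : ℝ} (hβ : 0 ≤ β) {a b : Fin m → ℝ}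
    (hab : ∀ i, a i ≤ b i)
    {γ : Measure ((Fin m → ℝ) × (Fin m → ℝ))} (hγ : IsProbabilityMeasure γ)
    (hfst : γ.map Prod.fst = μ) (hsnd : γ.map Prod.snd = ν)
    (h : ∀ᵐ q ∂γ, ∀ i, |q.1 i - q.2 i| ≤
      2 * β + (excess (a i) (b i) (q.1 i) + excess (a i) (b i) (q.2 i))) :
    WpN m p Nm μ ν ≤ C * (2 * (m : ℝ) ^ (1 / p) * β +
      ((∫ x, boxExcess p a b x ^ p ∂μ) ^ (1 / p) + (∫ x, boxExcess p a b x ^ p ∂ν) ^ (1 / p))) := by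
  have hp0 : 0 < p := by linarith
  have hbc := continuous_boxExcess hp a b
  have hbm : ∀ ρ : Measure (Fin m → ℝ),
      AEStronglyMeasurable (fun x => boxExcess p a b x ^ p) ρ := fun ρ =>
    (hbc.rpow_const fun _ => Or.inr hp0.le).aestronglyMeasurable
  have hA : MemLp (fun q : (Fin m → ℝ) × (Fin m → ℝ) => boxExcess p a b q.1)
      (ENNReal.ofReal p) γ := by
    refine memLp_of_integrable_rpow hp (fun q => boxExcess_nonneg _ _ _ _)
      (hbc.comp continuous_fst).aestronglyMeasurable ?_
    refine Integrable.comp_measurable (f := Prod.fst)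
      (g := fun x => boxExcess p a b x ^ p) ?_ measurable_fst
    rw [hfst]
    exact integrable_boxExcess_rpow hp hab hμ
  have hB : MemLp (fun q : (Fin m → ℝ) × (Fin m → ℝ) => boxExcess p a b q.2)
      (ENNReal.ofReal p) γ := by
    refine memLp_of_integrable_rpow hp (fun q => boxExcess_nonneg _ _ _ _)
      (hbc.comp continuous_snd).aestronglyMeasurable ?_
    refine Integrable.comp_measurable (f := Prod.snd)
      (g := fun x => boxExcess p a b x ^ p) ?_ measurable_snd
    rw [hsnd]
    exact integrable_boxExcess_rpow hp hab hν
  obtain ⟨hint, hle⟩ := Lp_bound_of_ae_le (F := fun q => Nm (q.1 - q.2))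
    (c := 2 * (m : ℝ) ^ (1 / p) * β) hp (by positivity) hC (fun q => hNm0 _)
    (fun q => boxExcess_nonneg _ _ _ _) (fun q => boxExcess_nonneg _ _ _ _)
    (hcont.comp (continuous_fst.sub continuous_snd)).aestronglyMeasurable hA hB (by
      filter_upwards [h] with q hq
      exact (hCnorm _).trans (mul_le_mul_of_nonneg_left (sum_abs_rpow_le hp hβ hq) hC))
  have e1 : ∫ q, boxExcess p a b q.1 ^ p ∂γ = ∫ x, boxExcess p a b x ^ p ∂μ := by
    rw [← hfst]
    exact (integral_map measurable_fst.aemeasurable (hbm _)).symm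
  have e2 : ∫ q, boxExcess p a b q.2 ^ p ∂γ = ∫ x, boxExcess p a b x ^ p ∂ν := by
    rw [← hsnd]
    exact (integral_map measurable_snd.aemeasurable (hbm _)).symm
  rw [e1, e2] at hle
  refine le_trans ?_ hle
  rw [WpN]
  refine csInf_le ⟨0, ?_⟩ ⟨γ, hγ, hfst, hsnd, hint, rfl⟩
  rintro r ⟨γ', -, -, -, -, rfl⟩
  exact Real.rpow_nonneg (integral_nonneg fun q => Real.rpow_nonneg (hNm0 _) _) _

end Coupling

section Moments

variable {m : ℕ} {p : ℝ}

theorem bestCall_mem_bestOfCallG {β : ℝ} {n : Fin m → ℕ} {κ : Fin m → ℝ} (L : Finset (Fin m))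
    (j : Fin m → ℕ) (hj : ∀ i ∈ L, j i ≤ n i) :
    bestCall L (fun i => κ i + (j i : ℝ) * β) ∈ bestOfCallG m p β n κ :=
  Or.inl ⟨L, j, hj, rfl⟩

theorem integral_boxExcess_eq_of_moments (hp : 1 ≤ p) {β : ℝ} (hβ : 0 ≤ β) {n : Fin m → ℕ}
    {κ : Fin m → ℝ} {μ ν : Measure (Fin m → ℝ)} [IsFiniteMeasure μ]
    [IsFiniteMeasure ν] (hμ : Integrable (fun x => ‖x‖ ^ p) μ)
    (hν : Integrable (fun x => ‖x‖ ^ p) ν) (huniv : μ Set.univ = ν Set.univ)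
    (h : ∀ g ∈ bestOfCallG m p β n κ, ∫ x, g x ∂ν = ∫ x, g x ∂μ) :
    ∫ x, boxExcess p κ (fun i => κ i + (n i : ℝ) * β) x ^ p ∂ν =
      ∫ x, boxExcess p κ (fun i => κ i + (n i : ℝ) * β) x ^ p ∂μ := by
  have hab : ∀ i, κ i ≤ κ i + (n i : ℝ) * β := fun i =>
    le_add_of_nonneg_right (by positivity)
  rw [integral_boxExcess_rpow hp hab hμ, integral_boxExcess_rpow hp hab hν]
  refine Finset.sum_congr rfl fun i _ => ?_
  by_cases h1 : p = 1
  · subst h1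
    simp only [Real.rpow_one] at hμ hν ⊢
    have hcall : ∀ j : ℕ, j ≤ n i →
        ∫ x, max (x i - (κ i + (j : ℝ) * β)) 0 ∂ν = ∫ x, max (x i - (κ i + (j : ℝ) * β)) 0 ∂μ := by
      intro j hj
      have := h _ (bestCall_mem_bestOfCallG (p := 1) (β := β) (n := n) (κ := κ) {i} (fun _ => j)
        (by simpa using hj))
      simpa only [bestCall_singleton] using this
    have hcoord : ∫ x, x i ∂ν = ∫ x, x i ∂μ :=
      h _ (Or.inr (by rw [if_pos rfl]; exact ⟨i, rfl⟩))
    have hput : ∀ ρ : Measure (Fin m → ℝ), IsFiniteMeasure ρ → Integrable (fun x => ‖x‖) ρ →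
        ∫ x, max (κ i - x i) 0 ∂ρ =
          ρ.real Set.univ * κ i - (∫ x, x i ∂ρ) + ∫ x, max (x i - κ i) 0 ∂ρ := by
      intro ρ _ hρ
      have hi : Integrable (fun x : Fin m → ℝ => x i) ρ :=
        hρ.mono' (measurable_pi_apply i).aestronglyMeasurable (Filter.Eventually.of_forall fun x => norm_le_pi_norm x i)
      have hr : Integrable (fun x : Fin m → ℝ => max (x i - κ i) 0) ρ := by
        simpa using integrable_max_sub_right_rpow le_rfl (by simpa using hρ) (κ i) i
      have heq : ∀ x : Fin m → ℝ, max (κ i - x i) 0 = κ i - x i + max (x i - κ i) 0 := by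
        intro x
        rcases le_total (x i) (κ i) with hx | hx
        · rw [max_eq_left (by linarith), max_eq_right (by linarith), add_zero]
        · rw [max_eq_right (by linarith), max_eq_left (by linarith)]
          ring
      simp only [heq]
      rw [integral_add (show Integrable (fun x => κ i - x i) ρ from (integrable_const _).sub hi) hr,
        integral_sub (integrable_const _) hi,
        integral_const, smul_eq_mul]
    have h0 := hcall 0 (Nat.zero_le _)
    simp only [Nat.cast_zero, zero_mul, add_zero] at h0
    rw [hput ν inferInstance hν, hput μ inferInstance hμ, hcoord, h0, hcall (n i) le_rfl,
      Measure.real, Measure.real, huniv]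
  · congr 1
    · exact h _ (Or.inr (by rw [if_neg h1]; exact Or.inl ⟨i, rfl⟩))
    · exact h _ (Or.inr (by rw [if_neg h1]; exact Or.inr ⟨i, rfl⟩))

end Moments

/-- **Corollary 5.4**: (a) the `W_p`-distance between `μ` and any probability measure `ν`
with the same `G`-moments is at most
`2 C m^{1/p} β + 2 C (Σ_i ∫ ((κ_{i,0} − t)⁺)^p + ((t − κ_{i,n_i})⁺)^p μ_i(dt))^{1/p}`;
(b) for every `ε > 0` one can choose `β`, `(n_i)`, `(κ̲_i)` so that the corresponding
supremum of `W_p(μ, ν)` is at most `ε`. -/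
theorem best_of_call_Wp_bound {m : ℕ} (p : ℝ) (hp : 1 ≤ p)
    (Nm : (Fin m → ℝ) → ℝ)
    (hNm_add : ∀ x y, Nm (x + y) ≤ Nm x + Nm y)
    (hNm_smul : ∀ (c : ℝ) (x), Nm (c • x) = |c| * Nm x)
    (hNm_def : ∀ x, Nm x = 0 → x = 0)
    (μ : Measure (Fin m → ℝ)) (hμprob : IsProbabilityMeasure μ)
    (hμmom : Integrable (fun x => Nm x ^ p) μ)
    (C : ℝ) (hC : 1 ≤ C)
    (hCnorm : ∀ x, Nm x ≤ C * (∑ i, |x i| ^ p) ^ (1 / p)) :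
    (∀ (β : ℝ), 0 < β → ∀ (n : Fin m → ℕ), (∀ i, 0 < n i) → ∀ (κ : Fin m → ℝ),
      ∀ ν : Measure (Fin m → ℝ), IsProbabilityMeasure ν →
        Integrable (fun x => Nm x ^ p) ν →
        (∀ g ∈ bestOfCallG m p β n κ,
          Integrable (fun x => |g x| ^ p) ν ∧ (∫ x, g x ∂ν) = ∫ x, g x ∂μ) →
        WpN m p Nm μ ν ≤
          2 * C * (m : ℝ) ^ (1 / p) * β +
            2 * C * (∑ i, ∫ t, ((max (κ i - t) 0) ^ p +
              (max (t - (κ i + (n i : ℝ) * β)) 0) ^ p) ∂(μ.map (fun x => x i))) ^ (1 / p)) ∧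
    (∀ ε : ℝ, 0 < ε →
      ∃ (β : ℝ) (n : Fin m → ℕ) (κ : Fin m → ℝ), 0 < β ∧ (∀ i, 0 < n i) ∧
        ∀ ν : Measure (Fin m → ℝ), IsProbabilityMeasure ν →
          Integrable (fun x => Nm x ^ p) ν →
          (∀ g ∈ bestOfCallG m p β n κ,
            Integrable (fun x => |g x| ^ p) ν ∧ (∫ x, g x ∂ν) = ∫ x, g x ∂μ) →
          WpN m p Nm μ ν ≤ ε) := by
  have hp0 : 0 < p := by linarith
  have hC0 : 0 ≤ C := by linarith
  have hNm0 := norm_fun_nonneg hNm_add hNm_smul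
  have hcont := continuous_norm_fun hp hNm_add hNm_smul hCnorm
  obtain ⟨c, hc0, hc⟩ := exists_mul_norm_le hNm_add hNm_smul hNm_def hcont
  have hmom : ∀ ρ : Measure (Fin m → ℝ), Integrable (fun x => Nm x ^ p) ρ →
      Integrable (fun x => ‖x‖ ^ p) ρ := fun ρ hρ => integrable_norm_rpow_of_le hp hc hc0 hNm0 hρ
  have hμ := hmom μ hμmom
  have hbound : ∀ (β : ℝ), 0 < β → ∀ (n : Fin m → ℕ), ∀ (κ : Fin m → ℝ),
      ∀ ν : Measure (Fin m → ℝ), IsProbabilityMeasure ν → Integrable (fun x => Nm x ^ p) ν →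
        (∀ g ∈ bestOfCallG m p β n κ,
          Integrable (fun x => |g x| ^ p) ν ∧ (∫ x, g x ∂ν) = ∫ x, g x ∂μ) →
        WpN m p Nm μ ν ≤ 2 * C * (m : ℝ) ^ (1 / p) * β + 2 * C *
          (∫ x, boxExcess p κ (fun i => κ i + (n i : ℝ) * β) x ^ p ∂μ) ^ (1 / p) := by
    intro β hβ n κ ν hν hνmom hG
    have hν' := hmom ν hνmom
    obtain ⟨γ, hγ, hfst, hsnd, hae⟩ := exists_grid_coupling (integrable_norm_of_rpow hp hμ)
      (integrable_norm_of_rpow hp hν') hβ n κ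
      fun L j hj => (hG _ (bestCall_mem_bestOfCallG L j hj)).2
    refine (WpN_le_of_coupling hp hNm0 hcont hC0 hCnorm hμ hν' hβ.le
      (fun i => le_add_of_nonneg_right (by positivity)) hγ hfst hsnd hae).trans (le_of_eq ?_)
    rw [integral_boxExcess_eq_of_moments hp hβ.le hμ hν' (by simp) fun g hg => (hG g hg).2]
    ring
  refine ⟨fun β hβ n _ κ ν hν hνmom hG => ?_, fun ε hε => ?_⟩
  · rw [sum_integral_map_eq hp (fun i => le_add_of_nonneg_right (by positivity)) hμ]
    exact hbound β hβ n κ ν hν hνmom hG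
  · have hD : 0 < 2 * C * (m : ℝ) ^ (1 / p) + 1 := by positivity
    set β := ε / 2 / (2 * C * (m : ℝ) ^ (1 / p) + 1) with hβdef
    have hβ : 0 < β := by positivity
    have h1 : 2 * C * (m : ℝ) ^ (1 / p) * β ≤ ε / 2 := by
      have : (2 * C * (m : ℝ) ^ (1 / p) + 1) * β = ε / 2 := by
        rw [hβdef]
        field_simp
      linarith
    have hlim := ((integral_boxExcess_rpow_tendsto hβ hp hμ).rpow_const
      (Or.inr (by positivity : 0 ≤ 1 / p))).const_mul (2 * C)
    rw [Real.zero_rpow (by positivity), mul_zero] at hlim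
    obtain ⟨N, hN, hN1⟩ := ((hlim.eventually_le_const (half_pos hε)).and
      (Filter.eventually_ge_atTop 1)).exists
    refine ⟨β, fun _ => 2 * N, fun _ => -(N * β), hβ, fun _ => by positivity, ?_⟩
    intro ν hν hνmom hG
    have h2 := hbound β hβ _ _ ν hν hνmom hG
    have h3 : (fun _ : Fin m => -((N : ℝ) * β) + ((2 * N : ℕ) : ℝ) * β) = fun _ => N * β := by
      funext
      push_cast
      ring
    rw [h3] at h2
    linarith

end
end
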